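/- Let d ≥ 1, let Γ be a d×d symmetric positive definite real matrix, and let R be a lower triangular P-matrix (R_{ij} = 0 for i < j and every principal minor positive). Suppose that for each r ∈ (0,1) there are Borel probability measures π^r, ν_1^r, …, ν_d^r on ℝ₊^d satisfying the basic adjoint relationship. Then, as r → 0, the pushforward of π^r under the map z ↦ (r z_1, r² z_2, …, r^d z_d) converges weakly to the law of a vector (Z_1*, …, Z_d*) of independent random variables in which Z_k* is exponentially distributed with mean m_k = (u_kᵀ Γ u_k)/(2 u_kᵀ R_{:,k}) = (u_kᵀ Γ u_k)/(2 R_{kk}) > 0. -/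

import Mathlib

open MeasureTheory Filter

noncomputable section

namespace SRBMPaper

/-- The nonnegative orthant `ℝ₊^d`. -/
def posOrthant (d : ℕ) : Set (Fin d → ℝ) := {z | ∀ i, 0 ≤ z i}

/-- `R` is a P-matrix: every principal minor is positive. -/
def IsPMatrix {d : ℕ} (R : Matrix (Fin d) (Fin d) ℝ) : Prop :=
  ∀ s : Finset (Fin d),
    0 < (R.submatrix (fun i : s => (i : Fin d)) (fun i : s => (i : Fin d))).det

/-- `R` is a nonsingular M-matrix: nonpositive off-diagonal entries and
every principal minor positive. -/
def IsMMatrix {d : ℕ} (R : Matrix (Fin d) (Fin d) ℝ) : Prop :=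
  (∀ i j, i ≠ j → R i j ≤ 0) ∧ IsPMatrix R

/-- First-order partial derivative of `f` in coordinate `j`. -/
def pd1 {d : ℕ} (f : (Fin d → ℝ) → ℝ) (j : Fin d) (z : Fin d → ℝ) : ℝ :=
  fderiv ℝ f z (Pi.single j 1)

/-- Second-order partial derivative of `f` in coordinates `i`, `j`. -/
def pd2 {d : ℕ} (f : (Fin d → ℝ) → ℝ) (i j : Fin d) (z : Fin d → ℝ) : ℝ :=
  fderiv ℝ (fun w => pd1 f j w) z (Pi.single i 1)

/-- `f` is twice continuously differentiable and `f` together with all of its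
first- and second-order partial derivatives is bounded on the orthant. -/
def IsC2Bounded {d : ℕ} (f : (Fin d → ℝ) → ℝ) : Prop :=
  ContDiff ℝ 2 f ∧
    ∃ C : ℝ, ∀ z ∈ posOrthant d,
      |f z| ≤ C ∧ (∀ j, |pd1 f j z| ≤ C) ∧ (∀ i j, |pd2 f i j z| ≤ C)

/-- The basic adjoint relationship (BAR) at traffic-intensity parameter `r`. -/
def SatisfiesBAR {d : ℕ} (Γ R : Matrix (Fin d) (Fin d) ℝ) (r : ℝ)
    (π : Measure (Fin d → ℝ)) (ν : Fin d → Measure (Fin d → ℝ)) : Prop :=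
  ∀ f : (Fin d → ℝ) → ℝ, IsC2Bounded f →
    (1 / 2) * (∫ z, ∑ i, ∑ j, Γ i j * pd2 f i j z ∂π)
      - (∑ i : Fin d, r ^ ((i : ℕ) + 1) * ∫ z, ∑ j, R j i * pd1 f j z ∂π)
      + (∑ i : Fin d, r ^ ((i : ℕ) + 1) * ∫ z, ∑ j, R j i * pd1 f j z ∂(ν i)) = 0

/-- For every `r ∈ (0,1)`, `π r` is a Borel probability measure on the orthant,
each `ν i r` is a Borel probability measure on the face `{z i = 0}` of the orthant,
and together they satisfy the basic adjoint relationship. -/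
def BARFamily {d : ℕ} (Γ R : Matrix (Fin d) (Fin d) ℝ)
    (π : ℝ → Measure (Fin d → ℝ)) (ν : Fin d → ℝ → Measure (Fin d → ℝ)) : Prop :=
  ∀ r ∈ Set.Ioo (0 : ℝ) 1,
    IsProbabilityMeasure (π r) ∧ π r (posOrthant d) = 1 ∧
    (∀ i, IsProbabilityMeasure (ν i r) ∧
      ν i r {z | z ∈ posOrthant d ∧ z i = 0} = 1) ∧
    SatisfiesBAR Γ R r (π r) (fun i => ν i r)

/-- `u` is the vector `u_k` associated with the matrix `R`:
`u_k = (w_{1k}, …, w_{k-1,k}, 1, 0, …, 0)ᵀ` where the weights solve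
`∑_{j<k} w_{jk} R_{jℓ} + R_{kℓ} = 0` for all `ℓ < k`. -/
def IsUk {d : ℕ} (R : Matrix (Fin d) (Fin d) ℝ) (k : Fin d) (u : Fin d → ℝ) : Prop :=
  u k = 1 ∧ (∀ j, k < j → u j = 0) ∧
    ∀ ℓ, ℓ < k →
      (∑ j ∈ Finset.univ.filter (fun j => j < k), u j * R j ℓ) + R k ℓ = 0

/-- `uᵀ R_{:,i}`, the pairing of `u` with the `i`-th column of `R`. -/
def uR {d : ℕ} (R : Matrix (Fin d) (Fin d) ℝ) (u : Fin d → ℝ) (i : Fin d) : ℝ :=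
  ∑ j, u j * R j i

/-- The quadratic form `uᵀ Γ u`. -/
def quadForm {d : ℕ} (Γ : Matrix (Fin d) (Fin d) ℝ) (u : Fin d → ℝ) : ℝ :=
  ∑ i, ∑ j, u i * Γ i j * u j

/-- The limiting mean `m_k = (u_kᵀ Γ u_k) / (2 u_kᵀ R_{:,k})`. -/
def meanOf {d : ℕ} (Γ R : Matrix (Fin d) (Fin d) ℝ) (u : Fin d → ℝ) (k : Fin d) : ℝ :=
  quadForm Γ u / (2 * uR R u k)

/-- The exponential distribution on `ℝ` with mean `m`. -/
def expMean (m : ℝ) : Measure ℝ :=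
  (volume : Measure ℝ).withDensity fun x =>
    ENNReal.ofReal (if 0 ≤ x then m⁻¹ * Real.exp (-x / m) else 0)

/-- The law of a vector of independent exponential random variables with means `m k`. -/
def prodExp {d : ℕ} (m : Fin d → ℝ) : Measure (Fin d → ℝ) :=
  Measure.pi fun k => expMean (m k)

/-- The pushforwards of `π r` under `z ↦ (r z_1, r² z_2, …, r^d z_d)` converge weakly
to `μ` as `r → 0` (convergence tested against bounded continuous functions). -/
def ScaledWeakLimit {d : ℕ} (π : ℝ → Measure (Fin d → ℝ)) (μ : Measure (Fin d → ℝ)) : Prop :=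
  ∀ g : BoundedContinuousFunction (Fin d → ℝ) ℝ,
    Tendsto (fun r : ℝ => ∫ z, g (fun i => r ^ ((i : ℕ) + 1) * z i) ∂(π r))
      (nhdsWithin 0 (Set.Ioo 0 1)) (nhds (∫ z, g z ∂μ))

/-- The uniform moment bound condition: for all coordinates `i, k`, the `d`-th moment
of `r^k Z_k` under `π r` is bounded for small `r`, and `r` times its `d`-th moment
under `ν i r` tends to `0` as `r → 0`. -/
def UniformMomentBound {d : ℕ} (π : ℝ → Measure (Fin d → ℝ))
    (ν : Fin d → ℝ → Measure (Fin d → ℝ)) : Prop :=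
  ∀ i k : Fin d,
    (∃ r₁ > (0 : ℝ), ∃ C : ℝ, ∀ r ∈ Set.Ioo (0 : ℝ) (min r₁ 1),
      (∫ z, (r ^ ((k : ℕ) + 1) * z k) ^ d ∂(π r)) ≤ C) ∧
    Tendsto (fun r : ℝ => r * ∫ z, (r ^ ((k : ℕ) + 1) * z k) ^ d ∂(ν i r))
      (nhdsWithin 0 (Set.Ioo 0 1)) (nhds 0)

/-- The truncation function `κ`. -/
def kappa (x : ℝ) : ℝ :=
  if x ≤ 1 then x
  else if x ≤ 2 then 3*x^5 - 22*x^4 + 62*x^3 - 84*x^2 + 56*x - 14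
  else 2

/-- The vector `θ_k^{(r)} = ∑_{ℓ=k}^d r^ℓ η_ℓ u_ℓ`. -/
def thetaK {d : ℕ} (u : Fin d → Fin d → ℝ) (η : Fin d → ℝ) (k : Fin d) (r : ℝ) :
    Fin d → ℝ :=
  fun j => ∑ ℓ ∈ Finset.univ.filter (fun ℓ => k ≤ ℓ), r ^ ((ℓ : ℕ) + 1) * η ℓ * u ℓ j

/-- The vector `θ̃_k^{(r)} = r^{k+1/2} η_k u_k + ∑_{ℓ=k+1}^d r^ℓ η_ℓ u_ℓ`. -/
def thetaKt {d : ℕ} (u : Fin d → Fin d → ℝ) (η : Fin d → ℝ) (k : Fin d) (r : ℝ) :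
    Fin d → ℝ :=
  fun j => r ^ ((((k : ℕ) : ℝ) + 1) + 1/2) * η k * u k j
    + ∑ ℓ ∈ Finset.univ.filter (fun ℓ => k < ℓ), r ^ ((ℓ : ℕ) + 1) * η ℓ * u ℓ j

/-- The truncated exponential test function `f̃_θ(z) = exp(∑ κ(θ_i z_i))`. -/
def ftilde {d : ℕ} (θ z : Fin d → ℝ) : ℝ := Real.exp (∑ i, kappa (θ i * z i))

/-- Gradient extra term `ε_{g,θ,j}(z) = θ_j (κ'(θ_j z_j) − 1)`. -/
def epsG {d : ℕ} (θ : Fin d → ℝ) (j : Fin d) (z : Fin d → ℝ) : ℝ :=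
  θ j * (deriv kappa (θ j * z j) - 1)

/-- Hessian extra term `ε_{H,θ,ij}(z)`. -/
def epsH {d : ℕ} (θ : Fin d → ℝ) (i j : Fin d) (z : Fin d → ℝ) : ℝ :=
  θ i * θ j * (deriv kappa (θ i * z i) * deriv kappa (θ j * z j) - 1)
    + (if i = j then θ i ^ 2 * deriv (deriv kappa) (θ i * z i) else 0)

/-- The extra term `γ^r(θ)` in the truncated MGF-BAR. -/
def gammaTerm {d : ℕ} (Γ R : Matrix (Fin d) (Fin d) ℝ) (r : ℝ)
    (π : Measure (Fin d → ℝ)) (ν : Fin d → Measure (Fin d → ℝ))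
    (θ : Fin d → ℝ) : ℝ :=
  (1/2) * (∫ z, (∑ i, ∑ j, Γ i j * epsH θ i j z) * ftilde θ z ∂π)
    + ∑ i : Fin d, r ^ ((i : ℕ) + 1) *
        ((∫ z, (∑ j, epsG θ j z * R j i) * ftilde θ z ∂(ν i))
          - ∫ z, (∑ j, epsG θ j z * R j i) * ftilde θ z ∂π)

section

/-- `p` is twice differentiable with derivatives `p₁`, `p₂`, all three bounded by `B`, and `p₂`
continuous. -/
structure IsBddC2 (p p₁ p₂ : ℝ → ℝ) (B : ℝ) : Prop where
  hasDerivAt : ∀ x, HasDerivAt p (p₁ x) x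
  hasDerivAt' : ∀ x, HasDerivAt p₁ (p₂ x) x
  continuous₂ : Continuous p₂
  bound : ∀ x, |p x| ≤ B
  bound₁ : ∀ x, |p₁ x| ≤ B
  bound₂ : ∀ x, |p₂ x| ≤ B

namespace IsBddC2

variable {p p₁ p₂ : ℝ → ℝ} {B : ℝ}

lemma continuous (h : IsBddC2 p p₁ p₂ B) : Continuous p :=
  continuous_iff_continuousAt.2 fun x => (h.hasDerivAt x).continuousAt

lemma continuous₁ (h : IsBddC2 p p₁ p₂ B) : Continuous p₁ :=
  continuous_iff_continuousAt.2 fun x => (h.hasDerivAt' x).continuousAt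

lemma nonneg (h : IsBddC2 p p₁ p₂ B) : 0 ≤ B := (abs_nonneg _).trans (h.bound 0)

lemma contDiff (h : IsBddC2 p p₁ p₂ B) : ContDiff ℝ 2 p := by
  have e1 : deriv p = p₁ := funext fun x => (h.hasDerivAt x).deriv
  have e2 : deriv p₁ = p₂ := funext fun x => (h.hasDerivAt' x).deriv
  have h1 : ContDiff ℝ 1 p₁ := contDiff_one_iff_deriv.2
    ⟨fun x => (h.hasDerivAt' x).differentiableAt, e2 ▸ h.continuous₂⟩
  have : ContDiff ℝ (1 + 1) p := contDiff_succ_iff_deriv.2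
    ⟨fun x => (h.hasDerivAt x).differentiableAt, by simp, e1 ▸ h1⟩
  simpa [one_add_one_eq_two] using this

end IsBddC2

variable {d : ℕ}

/-- The bilinear form `aᵀ Γ b`. -/
def bilin (Γ : Matrix (Fin d) (Fin d) ℝ) (a b : Fin d → ℝ) : ℝ :=
  ∑ i, ∑ j, a i * Γ i j * b j

lemma hasFDerivAt_dotProduct (a z : Fin d → ℝ) :
    HasFDerivAt (fun w : Fin d → ℝ => a ⬝ᵥ w)
      (∑ i, a i • ContinuousLinearMap.proj (R := ℝ) (φ := fun _ : Fin d => ℝ) i) z := by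
  have : (fun w : Fin d → ℝ => a ⬝ᵥ w) =
      (∑ i, a i • ContinuousLinearMap.proj (R := ℝ) (φ := fun _ : Fin d => ℝ) i :
        (Fin d → ℝ) →L[ℝ] ℝ) := by
    ext w
    simp [dotProduct]
  rw [this]
  exact ContinuousLinearMap.hasFDerivAt _

lemma sum_smul_proj_single (a : Fin d → ℝ) (j : Fin d) :
    (∑ i, a i • ContinuousLinearMap.proj (R := ℝ) (φ := fun _ : Fin d => ℝ) i :
        (Fin d → ℝ) →L[ℝ] ℝ) (Pi.single j 1) = a j := by
  simp [Pi.single_apply]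

lemma pd1_mul_ridge {p p' q q' : ℝ → ℝ} (hp : ∀ x, HasDerivAt p (p' x) x)
    (hq : ∀ x, HasDerivAt q (q' x) x) (a b z : Fin d → ℝ) (j : Fin d) :
    HasFDerivAt (fun w => p (a ⬝ᵥ w) * q (b ⬝ᵥ w))
      (fderiv ℝ (fun w => p (a ⬝ᵥ w) * q (b ⬝ᵥ w)) z) z ∧
    pd1 (fun w => p (a ⬝ᵥ w) * q (b ⬝ᵥ w)) j z =
      a j * (p' (a ⬝ᵥ z) * q (b ⬝ᵥ z)) + b j * (p (a ⬝ᵥ z) * q' (b ⬝ᵥ z)) := by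
  have h1 := (hp (a ⬝ᵥ z)).comp_hasFDerivAt z (hasFDerivAt_dotProduct a z)
  have h2 := (hq (b ⬝ᵥ z)).comp_hasFDerivAt z (hasFDerivAt_dotProduct b z)
  have h := h1.mul h2
  refine ⟨h.differentiableAt.hasFDerivAt, ?_⟩
  have : pd1 (fun w => p (a ⬝ᵥ w) * q (b ⬝ᵥ w)) j z = _ :=
    congrArg (fun L : (Fin d → ℝ) →L[ℝ] ℝ => L (Pi.single j 1)) h.fderiv
  rw [this]
  simp only [add_apply, smul_apply, sum_smul_proj_single,
    smul_eq_mul, Function.comp]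
  ring

lemma pd2_mul_ridge {p p₁ p₂ q q₁ q₂ : ℝ → ℝ} {B B' : ℝ} (hp : IsBddC2 p p₁ p₂ B)
    (hq : IsBddC2 q q₁ q₂ B') (a b z : Fin d → ℝ) (i j : Fin d) :
    pd2 (fun w => p (a ⬝ᵥ w) * q (b ⬝ᵥ w)) i j z =
      a i * a j * (p₂ (a ⬝ᵥ z) * q (b ⬝ᵥ z)) +
      (b i * a j + a i * b j) * (p₁ (a ⬝ᵥ z) * q₁ (b ⬝ᵥ z)) +
      b i * b j * (p (a ⬝ᵥ z) * q₂ (b ⬝ᵥ z)) := by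
  have e : (fun w => pd1 (fun w => p (a ⬝ᵥ w) * q (b ⬝ᵥ w)) j w) =
      fun w => a j * (p₁ (a ⬝ᵥ w) * q (b ⬝ᵥ w)) + b j * (p (a ⬝ᵥ w) * q₁ (b ⬝ᵥ w)) := by
    ext w
    exact (pd1_mul_ridge hp.hasDerivAt hq.hasDerivAt a b w j).2
  obtain ⟨h1, e1⟩ := pd1_mul_ridge hp.hasDerivAt' hq.hasDerivAt a b z i
  obtain ⟨h2, e2⟩ := pd1_mul_ridge hp.hasDerivAt hq.hasDerivAt' a b z i
  have h := (h1.const_mul (a j)).add (h2.const_mul (b j))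
  have h3 : fderiv ℝ (fun w => pd1 (fun w => p (a ⬝ᵥ w) * q (b ⬝ᵥ w)) j w) z = _ :=
    (congrArg (fun f => fderiv ℝ f z) e).trans h.fderiv
  rw [pd2, h3]
  simp only [add_apply, smul_apply, smul_eq_mul]
  rw [pd1] at e1 e2
  rw [e1, e2]
  ring

lemma isC2Bounded_mul_ridge {p p₁ p₂ q q₁ q₂ : ℝ → ℝ} {B B' : ℝ} (hp : IsBddC2 p p₁ p₂ B)
    (hq : IsBddC2 q q₁ q₂ B') (a b : Fin d → ℝ) :
    IsC2Bounded (fun w => p (a ⬝ᵥ w) * q (b ⬝ᵥ w)) := by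
  have hB := hp.nonneg
  have hB' := hq.nonneg
  refine ⟨?_, ?_⟩
  · have ha : ∀ a : Fin d → ℝ, ContDiff ℝ 2 (fun w : Fin d → ℝ => a ⬝ᵥ w) := by
      intro a
      unfold dotProduct
      fun_prop
    exact (hp.contDiff.comp (ha a)).mul (hq.contDiff.comp (ha b))
  · have key : ∀ x y x' y' : ℝ, |x| ≤ B → |y| ≤ B' → |x * y| ≤ B * B' := by
      intro x y _ _ hx hy
      rw [abs_mul]
      gcongr
    have ha : ∀ (a : Fin d → ℝ) j, |a j| ≤ ∑ i, |a i| := fun a j =>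
      Finset.single_le_sum (f := fun i => |a i|) (fun _ _ => abs_nonneg _) (Finset.mem_univ j)
    set S := ∑ i, |a i| with hS
    set T := ∑ i, |b i| with hT
    have hS0 : 0 ≤ S := Finset.sum_nonneg fun _ _ => abs_nonneg _
    have hT0 : 0 ≤ T := Finset.sum_nonneg fun _ _ => abs_nonneg _
    set P := B * B' with hP
    have hP0 : 0 ≤ P := mul_nonneg hB hB'
    have kf : ∀ c x M : ℝ, |c| ≤ M → |x| ≤ P → |c * x| ≤ M * P := by
      intro c x M hc hx
      rw [abs_mul]
      have := (abs_nonneg c).trans hc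
      gcongr
    refine ⟨P + (S + T) * P + (S + T) ^ 2 * P, fun z _ => ?_⟩
    have k1 : ∀ j, |pd1 (fun w => p (a ⬝ᵥ w) * q (b ⬝ᵥ w)) j z| ≤ (S + T) * P := by
      intro j
      rw [(pd1_mul_ridge hp.hasDerivAt hq.hasDerivAt a b z j).2, add_mul]
      refine (abs_add_le _ _).trans (add_le_add ?_ ?_)
      · exact kf _ _ _ (ha a j) (key _ _ 0 0 (hp.bound₁ _) (hq.bound _))
      · exact kf _ _ _ (ha b j) (key _ _ 0 0 (hp.bound _) (hq.bound₁ _))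
    have hm : ∀ (a b : Fin d → ℝ) i j, |a i * b j| ≤ (∑ i, |a i|) * ∑ i, |b i| := by
      intro a b i j
      rw [abs_mul]
      gcongr
      exacts [ha a i, ha b j]
    have k2 : ∀ i j, |pd2 (fun w => p (a ⬝ᵥ w) * q (b ⬝ᵥ w)) i j z| ≤ (S + T) ^ 2 * P := by
      intro i j
      rw [pd2_mul_ridge hp hq a b z i j]
      have : (S + T) ^ 2 * P = S * S * P + (T * S + S * T) * P + T * T * P := by ring
      rw [this]
      refine (abs_add_le _ _).trans (add_le_add ((abs_add_le _ _).trans (add_le_add ?_ ?_)) ?_)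
      · exact kf _ _ _ (hm a a i j) (key _ _ 0 0 (hp.bound₂ _) (hq.bound _))
      · refine kf _ _ _ ((abs_add_le _ _).trans (add_le_add (hm b a i j) (hm a b i j)))
          (key _ _ 0 0 (hp.bound₁ _) (hq.bound₁ _))
      · exact kf _ _ _ (hm b b i j) (key _ _ 0 0 (hp.bound _) (hq.bound₂ _))
    have q1 : 0 ≤ (S + T) * P := by positivity
    have q2 : 0 ≤ (S + T) ^ 2 * P := by positivity
    have q3 := key _ _ 0 0 (hp.bound (a ⬝ᵥ z)) (hq.bound (b ⬝ᵥ z))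
    exact ⟨by linarith, fun j => by linarith [k1 j], fun i j => by linarith [k2 i j]⟩

lemma SatisfiesBAR.mul_ridge {Γ R : Matrix (Fin d) (Fin d) ℝ} {r : ℝ}
    {π : Measure (Fin d → ℝ)} {ν : Fin d → Measure (Fin d → ℝ)} (h : SatisfiesBAR Γ R r π ν)
    {p p₁ p₂ q q₁ q₂ : ℝ → ℝ} {B B' : ℝ} (hp : IsBddC2 p p₁ p₂ B)
    (hq : IsBddC2 q q₁ q₂ B') (a b : Fin d → ℝ) :
    (1 / 2) * (∫ z, (bilin Γ a a * (p₂ (a ⬝ᵥ z) * q (b ⬝ᵥ z)) +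
        (bilin Γ b a + bilin Γ a b) * (p₁ (a ⬝ᵥ z) * q₁ (b ⬝ᵥ z)) +
        bilin Γ b b * (p (a ⬝ᵥ z) * q₂ (b ⬝ᵥ z))) ∂π)
      + ∑ i : Fin d, r ^ ((i : ℕ) + 1) *
        ((∫ z, (uR R a i * (p₁ (a ⬝ᵥ z) * q (b ⬝ᵥ z)) +
            uR R b i * (p (a ⬝ᵥ z) * q₁ (b ⬝ᵥ z))) ∂(ν i)) -
          ∫ z, (uR R a i * (p₁ (a ⬝ᵥ z) * q (b ⬝ᵥ z)) +
            uR R b i * (p (a ⬝ᵥ z) * q₁ (b ⬝ᵥ z))) ∂π) = 0 := by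
  have h0 := h _ (isC2Bounded_mul_ridge hp hq a b)
  have e1 : ∀ (i : Fin d) (z : Fin d → ℝ),
      ∑ j, R j i * pd1 (fun w => p (a ⬝ᵥ w) * q (b ⬝ᵥ w)) j z =
        uR R a i * (p₁ (a ⬝ᵥ z) * q (b ⬝ᵥ z)) + uR R b i * (p (a ⬝ᵥ z) * q₁ (b ⬝ᵥ z)) := by
    intro i z
    simp only [uR, Finset.sum_mul, ← Finset.sum_add_distrib]
    refine Finset.sum_congr rfl fun j _ => ?_
    rw [(pd1_mul_ridge hp.hasDerivAt hq.hasDerivAt a b z j).2]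
    ring
  have e2 : ∀ z : Fin d → ℝ,
      ∑ i, ∑ j, Γ i j * pd2 (fun w => p (a ⬝ᵥ w) * q (b ⬝ᵥ w)) i j z =
        bilin Γ a a * (p₂ (a ⬝ᵥ z) * q (b ⬝ᵥ z)) +
        (bilin Γ b a + bilin Γ a b) * (p₁ (a ⬝ᵥ z) * q₁ (b ⬝ᵥ z)) +
        bilin Γ b b * (p (a ⬝ᵥ z) * q₂ (b ⬝ᵥ z)) := by
    intro z
    simp only [bilin, ← Finset.sum_add_distrib, Finset.sum_mul]
    refine Finset.sum_congr rfl fun i _ => Finset.sum_congr rfl fun j _ => ?_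
    rw [pd2_mul_ridge hp hq a b z i j]
    ring
  simp only [e1, e2] at h0
  rw [← h0]
  simp only [mul_sub, Finset.sum_sub_distrib]
  ring

lemma isBddC2_sin_div {L : ℝ} (hL : 1 ≤ L) :
    IsBddC2 (fun x => L * Real.sin (x / L)) (fun x => Real.cos (x / L))
      (fun x => -Real.sin (x / L) / L) L := by
  have hL0 : (0 : ℝ) < L := by linarith
  refine ⟨fun x => ?_, fun x => ?_, by fun_prop, fun x => ?_, fun x => ?_, fun x => ?_⟩
  · have := ((Real.hasDerivAt_sin (x / L)).comp x ((hasDerivAt_id x).div_const L)).const_mul L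
    refine this.congr_deriv ?_
    field_simp
  · have := (Real.hasDerivAt_cos (x / L)).comp x ((hasDerivAt_id x).div_const L)
    refine this.congr_deriv ?_
    field_simp
  · rw [abs_mul, abs_of_pos hL0]
    exact mul_le_of_le_one_right hL0.le (Real.abs_sin_le_one _)
  · exact (Real.abs_cos_le_one _).trans hL
  · rw [abs_div, abs_neg, abs_of_pos hL0, div_le_iff₀ hL0]
    have := Real.abs_sin_le_one (x / L)
    nlinarith

/-- A smooth even cutoff, vanishing on `[-1, 1]` and equal to `1` outside `(-2, 2)`, together with
its first two derivatives. -/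
structure IsCutoff (g g₁ g₂ : ℝ → ℝ) (B : ℝ) : Prop extends IsBddC2 g g₁ g₂ B where
  nonneg' : ∀ x, 0 ≤ g x
  le_one : ∀ x, g x ≤ 1
  eq_one : ∀ x, 2 ≤ |x| → g x = 1
  eq_zero : ∀ x, |x| < 1 → g x = 0
  eq_zero₁ : ∀ x, |x| < 1 → g₁ x = 0
  eq_zero₂ : ∀ x, |x| < 1 → g₂ x = 0
  mul_nonneg₁ : ∀ x, 0 ≤ x * g₁ x
  eq_zero₁' : ∀ x, 2 < |x| → g₁ x = 0
  eq_zero₂' : ∀ x, 2 < |x| → g₂ x = 0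

lemma exists_isCutoff : ∃ g g₁ g₂ B, IsCutoff g g₁ g₂ B := by
  set g : ℝ → ℝ := fun x => Real.smoothTransition (x ^ 2 - 1) with hg
  have hc : ContDiff ℝ 2 g := by
    have := Real.smoothTransition.contDiff (n := 2)
    exact this.comp (by fun_prop)
  have hc1 : ContDiff ℝ 1 (deriv g) := by
    have : ContDiff ℝ (1 + 1) g := by simpa [one_add_one_eq_two] using hc
    exact (contDiff_succ_iff_deriv.1 this).2.2
  have hd1 : ∀ x, HasDerivAt g (deriv g x) x := fun x =>
    (hc.differentiable (by norm_num) x).hasDerivAt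
  have hd2 : ∀ x, HasDerivAt (deriv g) (deriv (deriv g) x) x := fun x =>
    (hc1.differentiable (by norm_num) x).hasDerivAt
  have hc2 : Continuous (deriv (deriv g)) := hc1.continuous_deriv le_rfl
  have z0 : ∀ x, |x| < 1 → g x = 0 := fun x hx => by
    refine Real.smoothTransition.zero_of_nonpos ?_
    have := sq_lt_one_iff_abs_lt_one x |>.2 hx
    linarith
  have o0 : ∀ x, 2 ≤ |x| → g x = 1 := fun x hx => by
    refine Real.smoothTransition.one_of_one_le ?_
    have : 2 ^ 2 ≤ |x| ^ 2 := by gcongr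
    rw [sq_abs] at this
    linarith
  have oz : IsOpen {x : ℝ | |x| < 1} := isOpen_lt continuous_abs continuous_const
  have oo : IsOpen {x : ℝ | 2 < |x|} := isOpen_lt continuous_const continuous_abs
  have dz : ∀ (f : ℝ → ℝ) (c : ℝ) (s : Set ℝ), IsOpen s → (∀ x ∈ s, f x = c) →
      ∀ x ∈ s, deriv f x = 0 := by
    intro f c s hs h x hx
    have : f =ᶠ[nhds x] fun _ => c := by
      filter_upwards [hs.mem_nhds hx] with y hy using h y hy
    rw [this.deriv_eq]
    simp
  have z1 : ∀ x, |x| < 1 → deriv g x = 0 := dz g 0 _ oz z0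
  have z2 : ∀ x, |x| < 1 → deriv (deriv g) x = 0 := dz _ 0 _ oz z1
  have o1 : ∀ x, 2 < |x| → deriv g x = 0 := dz g 1 _ oo fun x hx => o0 x (le_of_lt hx)
  have o2 : ∀ x, 2 < |x| → deriv (deriv g) x = 0 := dz _ 0 _ oo o1
  have bd : ∀ f : ℝ → ℝ, Continuous f → (∀ x, 2 < |x| → f x = 0) → ∃ C, 0 ≤ C ∧ ∀ x, |f x| ≤ C := by
    intro f hf h
    obtain ⟨C, hC⟩ := (isCompact_Icc (a := (-2 : ℝ)) (b := 2)).exists_bound_of_continuousOn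
      hf.continuousOn
    refine ⟨max C 0, le_max_right _ _, fun x => ?_⟩
    by_cases hx : 2 < |x|
    · simp [h x hx]
    · exact (hC x (abs_le.1 (not_lt.1 hx))).trans (le_max_left _ _)
  obtain ⟨C1, hC1, b1⟩ := bd _ hc1.continuous o1
  obtain ⟨C2, hC2, b2⟩ := bd _ hc2 o2
  have n0 : ∀ x, 0 ≤ g x := fun x => Real.smoothTransition.nonneg _
  have l1 : ∀ x, g x ≤ 1 := fun x => Real.smoothTransition.le_one _
  refine ⟨g, deriv g, deriv (deriv g), 1 + C1 + C2, ⟨⟨hd1, hd2, hc2, fun x => ?_, fun x => ?_,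
    fun x => ?_⟩, n0, l1, o0, z0, z1, z2, fun x => ?_, o1, o2⟩⟩
  · rw [abs_of_nonneg (n0 x)]
    linarith [l1 x]
  · linarith [b1 x]
  · linarith [b2 x]
  · have hs := (Real.smoothTransition.contDiff (n := 1)).differentiable (by norm_num) (x ^ 2 - 1)
    have h1 : HasDerivAt g (deriv Real.smoothTransition (x ^ 2 - 1) * (2 * x)) x := by
      have h2 : HasDerivAt (fun x : ℝ => x ^ 2 - 1) (2 * x) x := by
        simpa using (hasDerivAt_pow 2 x).sub_const 1
      exact hs.hasDerivAt.comp x h2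
    rw [h1.deriv]
    have := Real.smoothTransition.monotone.deriv_nonneg (x := x ^ 2 - 1)
    nlinarith [mul_nonneg this (sq_nonneg x)]

lemma IsCutoff.div {g g₁ g₂ : ℝ → ℝ} {B : ℝ} (h : IsCutoff g g₁ g₂ B) {A : ℝ} (hA : 1 ≤ A) :
    IsBddC2 (fun x => g (x / A)) (fun x => g₁ (x / A) / A) (fun x => g₂ (x / A) / A ^ 2) B := by
  have hA0 : (0 : ℝ) < A := by linarith
  have hB := h.nonneg
  have := h.continuous₂
  refine ⟨fun x => ?_, fun x => ?_, by fun_prop, fun x => h.bound _, fun x => ?_, fun x => ?_⟩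
  · exact ((h.hasDerivAt (x / A)).comp x ((hasDerivAt_id x).div_const A)).congr_deriv (by simp; rfl)
  · refine (((h.hasDerivAt' (x / A)).comp x ((hasDerivAt_id x).div_const A)).div_const
      A).congr_deriv ?_
    field_simp
  · rw [abs_div, abs_of_pos hA0]
    exact (div_le_self (abs_nonneg _) hA).trans (h.bound₁ _)
  · rw [abs_div, abs_of_pos (by positivity : (0 : ℝ) < A ^ 2)]
    exact (div_le_self (abs_nonneg _) (one_le_pow₀ hA)).trans (h.bound₂ _)

end

section

variable {d : ℕ}

lemma IsPMatrix.diag_pos {R : Matrix (Fin d) (Fin d) ℝ} (hR : IsPMatrix R) (k : Fin d) :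
    0 < R k k := by
  have := hR {k}
  rwa [Matrix.det_eq_elem_of_subsingleton _ (⟨k, by simp⟩ : ({k} : Finset (Fin d)))] at this

lemma IsUk.uR_eq {R : Matrix (Fin d) (Fin d) ℝ} (htri : ∀ i j : Fin d, i < j → R i j = 0)
    {k : Fin d} {u : Fin d → ℝ} (hu : IsUk R k u) (i : Fin d) :
    uR R u i = if i = k then R k k else 0 := by
  obtain ⟨h1, h2, h3⟩ := hu
  unfold uR
  split_ifs with h
  · subst h
    rw [Finset.sum_eq_single i]
    · rw [h1, one_mul]
    · intro j _ hj
      rcases lt_or_gt_of_ne hj with h | h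
      · rw [htri j i h, mul_zero]
      · rw [h2 j h, zero_mul]
    · simp
  · rcases lt_or_gt_of_ne h with h | h
    · rw [← h3 i h, Finset.sum_filter]
      have : R k i = ∑ j, if j = k then R k i else 0 := by simp
      rw [this, ← Finset.sum_add_distrib]
      refine Finset.sum_congr rfl fun j _ => ?_
      rcases lt_trichotomy j k with hj | hj | hj
      · simp [hj, hj.ne]
      · simp [hj, h1]
      · simp [hj.not_gt, hj.ne', h2 j hj]
    · refine Finset.sum_eq_zero fun j _ => ?_
      rcases le_or_gt j k with hj | hj
      · rw [htri j i (hj.trans_lt h), mul_zero]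
      · rw [h2 j hj, zero_mul]

lemma uR_single (R : Matrix (Fin d) (Fin d) ℝ) (k i : Fin d) :
    uR R (Pi.single k 1) i = R k i := by
  simp [uR, Pi.single_apply]

lemma bilin_self_pos {Γ : Matrix (Fin d) (Fin d) ℝ} (hΓ : Γ.PosDef) {u : Fin d → ℝ}
    (hu : u ≠ 0) : 0 < bilin Γ u u := by
  have := hΓ.dotProduct_mulVec_pos hu
  simpa [bilin, dotProduct, Matrix.mulVec, Finset.mul_sum, mul_assoc] using this

lemma abs_integral_le_mul_measureReal {α : Type*} [MeasurableSpace α] {μ : Measure α}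
    [IsFiniteMeasure μ] {f : α → ℝ} {E : Set α} (hE : MeasurableSet E) {K : ℝ}
    (h1 : ∀ z ∈ E, |f z| ≤ K) (h2 : ∀ z ∉ E, f z = 0) :
    |∫ z, f z ∂μ| ≤ K * μ.real E := by
  have : ∀ z, ‖f z‖ ≤ E.indicator (fun _ => K) z := by
    intro z
    by_cases hz : z ∈ E
    · simpa [hz] using h1 z hz
    · simp [hz, h2 z hz]
  calc |∫ z, f z ∂μ| = ‖∫ z, f z ∂μ‖ := (Real.norm_eq_abs _).symm
    _ ≤ ∫ z, E.indicator (fun _ => K) z ∂μ := by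
      refine norm_integral_le_of_norm_le ?_ (Eventually.of_forall this)
      exact (integrable_const K).indicator hE
    _ = K * μ.real E := by
      rw [integral_indicator_const _ hE, smul_eq_mul, mul_comm]

/-- The event that the linear functional `v` exceeds `A` in absolute value. -/
def tailSet (v : Fin d → ℝ) (A : ℝ) : Set (Fin d → ℝ) := {z | A ≤ |v ⬝ᵥ z|}

lemma continuous_dotProduct_left (v : Fin d → ℝ) : Continuous fun z : Fin d → ℝ => v ⬝ᵥ z := by
  unfold dotProduct
  fun_prop

lemma measurableSet_tailSet (v : Fin d → ℝ) (A : ℝ) : MeasurableSet (tailSet v A) :=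
  (isClosed_le continuous_const (continuous_dotProduct_left v).abs).measurableSet

/-- `π` and `ν i` are probability measures, `ν i` is carried by the hyperplane `z i = 0`, and the
basic adjoint relationship holds at `r ∈ (0, 1)`. -/
structure IsBARSolution (Γ R : Matrix (Fin d) (Fin d) ℝ) (r : ℝ) (π : Measure (Fin d → ℝ))
    (ν : Fin d → Measure (Fin d → ℝ)) : Prop where
  pos : 0 < r
  lt_one : r < 1
  prob : IsProbabilityMeasure π
  prob_boundary : ∀ i, IsProbabilityMeasure (ν i)
  ae_face : ∀ i, ∀ᵐ z ∂(ν i), z i = 0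
  bar : SatisfiesBAR Γ R r π ν

variable {Γ R : Matrix (Fin d) (Fin d) ℝ}

/-- A bound for all the coefficients in the basic adjoint relationship applied to
`p (a ⬝ᵥ z) * q (b ⬝ᵥ z)`. -/
def coeffBound (Γ R : Matrix (Fin d) (Fin d) ℝ) (a b : Fin d → ℝ) : ℝ :=
  |bilin Γ a a| + |bilin Γ b a + bilin Γ a b| + |bilin Γ b b| +
    ((∑ i, |uR R a i|) + ∑ i, |uR R b i|)

lemma coeffBound_nonneg (a b : Fin d → ℝ) : 0 ≤ coeffBound Γ R a b := by
  unfold coeffBound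
  positivity

/-- If the tail of `b ⬝ᵥ z` is small under the interior measure and all relevant boundary measures,
then the `k`-th boundary term in the basic adjoint relationship for `p (a ⬝ᵥ z) * g (b ⬝ᵥ z / A)`
is small. -/
lemma IsBARSolution.boundary_le {r : ℝ} {π : Measure (Fin d → ℝ)}
    {ν : Fin d → Measure (Fin d → ℝ)} (h : IsBARSolution Γ R r π ν)
    {p p₁ p₂ g g₁ g₂ : ℝ → ℝ} {B B' : ℝ} (hp : IsBddC2 p p₁ p₂ B) (hg : IsCutoff g g₁ g₂ B')
    {A : ℝ} (hA : 1 ≤ A) {a b : Fin d → ℝ} {k : Fin d} (hbk : uR R b k = 0) {ε : ℝ} (hε0 : 0 ≤ ε)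
    (hπ : π.real (tailSet b A) ≤ ε)
    (hν : ∀ i, i ≠ k → (uR R a i ≠ 0 ∨ uR R b i ≠ 0) → (ν i).real (tailSet b A) ≤ ε) :
    r ^ ((k : ℕ) + 1) * |uR R a k * ∫ z, p₁ (a ⬝ᵥ z) * g (b ⬝ᵥ z / A) ∂(ν k)| ≤
      (1 + 2 * d) * coeffBound Γ R a b * (B * B') * ε := by
  have := h.prob
  have := h.prob_boundary
  have hr := h.pos
  have hr1 := h.lt_one
  have hq := hg.div hA
  have hA0 : 0 < A := by linarith
  have hBB : 0 ≤ B * B' := mul_nonneg hp.nonneg hq.nonneg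
  set K := coeffBound Γ R a b * (B * B') with hK
  have hK0 : 0 ≤ K := mul_nonneg (coeffBound_nonneg a b) hBB
  have key : ∀ x y : ℝ, |x| ≤ B → |y| ≤ B' → |x * y| ≤ B * B' := by
    intro x y hx hy
    have := hp.nonneg
    rw [abs_mul]
    gcongr
  have hout : ∀ z ∉ tailSet b A, |b ⬝ᵥ z / A| < 1 := by
    intro z hz
    rw [abs_div, abs_of_pos hA0, div_lt_one hA0]
    exact not_le.1 hz
  have sa : ∀ i, |uR R a i| ≤ ∑ i, |uR R a i| := fun i =>
    Finset.single_le_sum (f := fun i => |uR R a i|) (fun _ _ => abs_nonneg _) (Finset.mem_univ i)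
  have sb : ∀ i, |uR R b i| ≤ ∑ i, |uR R b i| := fun i =>
    Finset.single_le_sum (f := fun i => |uR R b i|) (fun _ _ => abs_nonneg _) (Finset.mem_univ i)
  have mb : ∀ c x : ℝ, |x| ≤ B * B' → |c * x| ≤ |c| * (B * B') := by
    intro c x hx
    rw [abs_mul]
    gcongr
  set D : Fin d → (Fin d → ℝ) → ℝ := fun i z =>
    uR R a i * (p₁ (a ⬝ᵥ z) * g (b ⬝ᵥ z / A)) + uR R b i * (p (a ⬝ᵥ z) * (g₁ (b ⬝ᵥ z / A) / A))
    with hD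
  have bD : ∀ i (μ : Measure (Fin d → ℝ)) [IsProbabilityMeasure μ], μ.real (tailSet b A) ≤ ε →
      |∫ z, D i z ∂μ| ≤ K * ε := by
    intro i μ _ hμ
    refine (abs_integral_le_mul_measureReal (measurableSet_tailSet b A) (K := K) ?_ ?_).trans
      (by gcongr)
    · intro z _
      refine (abs_add_le _ _).trans ((add_le_add
        (mb _ _ (key _ _ (hp.bound₁ _) (hq.bound _)))
        (mb _ _ (key _ _ (hp.bound _) (hq.bound₁ _)))).trans ?_)
      rw [← add_mul, hK]
      refine mul_le_mul_of_nonneg_right ?_ hBB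
      have := sa i
      have := sb i
      unfold coeffBound
      have := abs_nonneg (bilin Γ a a)
      have := abs_nonneg (bilin Γ b b)
      have := abs_nonneg (bilin Γ b a + bilin Γ a b)
      linarith
    · intro z hz
      simp [hD, hg.eq_zero _ (hout z hz), hg.eq_zero₁ _ (hout z hz)]
  have bH : |∫ z, (bilin Γ a a * (p₂ (a ⬝ᵥ z) * g (b ⬝ᵥ z / A)) +
        (bilin Γ b a + bilin Γ a b) * (p₁ (a ⬝ᵥ z) * (g₁ (b ⬝ᵥ z / A) / A)) +
        bilin Γ b b * (p (a ⬝ᵥ z) * (g₂ (b ⬝ᵥ z / A) / A ^ 2))) ∂π| ≤ K * ε := by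
    refine (abs_integral_le_mul_measureReal (measurableSet_tailSet b A) (K := K) ?_ ?_).trans
      (by gcongr)
    · intro z _
      refine (abs_add_le _ _).trans ((add_le_add ((abs_add_le _ _).trans (add_le_add
        (mb _ _ (key _ _ (hp.bound₂ _) (hq.bound _)))
        (mb _ _ (key _ _ (hp.bound₁ _) (hq.bound₁ _)))))
        (mb _ _ (key _ _ (hp.bound _) (hq.bound₂ _)))).trans ?_)
      rw [← add_mul, ← add_mul, hK]
      refine mul_le_mul_of_nonneg_right ?_ hBB
      unfold coeffBound
      have : 0 ≤ (∑ i, |uR R a i|) + ∑ i, |uR R b i| := by positivity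
      linarith
    · intro z hz
      simp [hg.eq_zero _ (hout z hz), hg.eq_zero₁ _ (hout z hz), hg.eq_zero₂ _ (hout z hz)]
  have main := h.bar.mul_ridge hp hq a b
  rw [← Finset.add_sum_erase _ _ (Finset.mem_univ k)] at main
  have hDk : (∫ z, (uR R a k * (p₁ (a ⬝ᵥ z) * g (b ⬝ᵥ z / A)) +
      uR R b k * (p (a ⬝ᵥ z) * (g₁ (b ⬝ᵥ z / A) / A))) ∂(ν k)) =
      uR R a k * ∫ z, p₁ (a ⬝ᵥ z) * g (b ⬝ᵥ z / A) ∂(ν k) := by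
    rw [← integral_const_mul]
    simp [hbk]
  rw [hDk] at main
  have rk : ∀ i : Fin d, 0 < r ^ ((i : ℕ) + 1) ∧ r ^ ((i : ℕ) + 1) ≤ 1 := fun i =>
    ⟨by positivity, pow_le_one₀ hr.le hr1.le⟩
  have hsum : |∑ i ∈ Finset.univ.erase k, r ^ ((i : ℕ) + 1) *
      ((∫ z, D i z ∂(ν i)) - ∫ z, D i z ∂π)| ≤ (d - 1) * (2 * (K * ε)) := by
    have hcard : ((Finset.univ.erase k).card : ℝ) = d - 1 := by
      rw [Finset.card_erase_of_mem (Finset.mem_univ k), Finset.card_univ, Fintype.card_fin,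
        Nat.cast_sub k.pos]
      simp
    rw [← hcard, ← nsmul_eq_mul]
    refine (Finset.abs_sum_le_sum_abs _ _).trans (Finset.sum_le_card_nsmul _ _ _ fun i hi => ?_)
    have hik : i ≠ k := Finset.ne_of_mem_erase hi
    rw [abs_mul, abs_of_pos (rk i).1]
    refine (mul_le_of_le_one_left (abs_nonneg _) (rk i).2).trans ?_
    refine (abs_sub _ _).trans ?_
    have h1 := bD i π hπ
    have h2 : |∫ z, D i z ∂(ν i)| ≤ K * ε := by
      by_cases hc : uR R a i ≠ 0 ∨ uR R b i ≠ 0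
      · exact bD i _ (hν i hik hc)
      · push Not at hc
        simp only [hD, hc.1, hc.2, zero_mul, add_zero, integral_zero, abs_zero]
        positivity
    linarith
  have hk1 := bD k π hπ
  have hkk := rk k
  rw [← abs_of_pos hkk.1, ← abs_mul]
  set X := uR R a k * ∫ z, p₁ (a ⬝ᵥ z) * g (b ⬝ᵥ z / A) ∂(ν k)
  set Y := ∫ z, D k z ∂π
  set W := ∑ i ∈ Finset.univ.erase k, r ^ ((i : ℕ) + 1) *
      ((∫ z, D i z ∂(ν i)) - ∫ z, D i z ∂π)
  have hY : |r ^ ((k : ℕ) + 1) * Y| ≤ K * ε := by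
    rw [abs_mul, abs_of_pos hkk.1]
    exact (mul_le_of_le_one_left (abs_nonneg _) hkk.2).trans hk1
  have e : ∀ V : ℝ, 1 / 2 * V + (r ^ ((k : ℕ) + 1) * (X - Y) + W) = 0 →
      r ^ ((k : ℕ) + 1) * X = r ^ ((k : ℕ) + 1) * Y - W - 1 / 2 * V := by
    intro V hV
    linarith
  rw [e _ main]
  have hKe : 0 ≤ K * ε := by positivity
  refine (abs_sub _ _).trans ?_
  have := abs_sub (r ^ ((k : ℕ) + 1) * Y) W
  rw [abs_mul (1 / 2 : ℝ), abs_of_pos (by norm_num : (0 : ℝ) < 1 / 2)]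
  nlinarith

end

section

variable {d : ℕ} {Γ R : Matrix (Fin d) (Fin d) ℝ}

lemma tendsto_measureReal_tailSet (μ : Measure (Fin d → ℝ)) [IsFiniteMeasure μ] (v : Fin d → ℝ) :
    Tendsto (fun n : ℕ => μ.real (tailSet v n)) atTop (nhds 0) := by
  have h : Tendsto (fun n : ℕ => μ (tailSet v n)) atTop (nhds (μ (⋂ n : ℕ, tailSet v n))) := by
    refine tendsto_measure_iInter_atTop
      (fun n => (measurableSet_tailSet v n).nullMeasurableSet) ?_ ⟨0, measure_ne_top _ _⟩
    intro m n hmn z hz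
    have hz' : (n : ℝ) ≤ |v ⬝ᵥ z| := hz
    exact (Nat.cast_le.2 hmn).trans hz'
  have e : (⋂ n : ℕ, tailSet v n) = ∅ := by
    refine Set.eq_empty_of_forall_notMem fun z hz => ?_
    obtain ⟨n, hn⟩ := exists_nat_gt |v ⬝ᵥ z|
    exact absurd (Set.mem_iInter.1 hz n) (not_le.2 hn)
  rw [e, measure_empty] at h
  exact (ENNReal.tendsto_toReal ENNReal.zero_ne_top).comp h

lemma half_le_cos_div {x L : ℝ} (hx : |x| < L) : 1 / 2 ≤ Real.cos (x / L) := by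
  have hL : 0 < L := (abs_nonneg x).trans_lt hx
  have h1 : |x / L| ≤ 1 := by
    rw [abs_div, abs_of_pos hL, div_le_one hL]
    exact hx.le
  have h2 := Real.one_sub_sq_div_two_le_cos (x := x / L)
  have h3 : (x / L) ^ 2 ≤ 1 := by
    rw [← sq_abs]
    exact pow_le_one₀ (abs_nonneg _) h1
  linarith

lemma measureReal_le_integral_add {α : Type*} [MeasurableSpace α] {μ : Measure α}
    [IsFiniteMeasure μ] {f : α → ℝ} (hf : Integrable f μ) {E G : Set α} (hE : MeasurableSet E)
    (hG : MeasurableSet G) (h1 : ∀ z ∉ G, 0 ≤ f z) (h2 : ∀ z ∈ E, z ∉ G → 1 / 2 ≤ f z)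
    (h3 : ∀ z ∈ G, -1 ≤ f z) :
    μ.real E ≤ 2 * ∫ z, f z ∂μ + 3 * μ.real G := by
  have hi : ∀ E : Set α, MeasurableSet E → μ.real E = ∫ z, E.indicator (fun _ => (1 : ℝ)) z ∂μ :=
    fun E hE => by rw [integral_indicator_const _ hE, smul_eq_mul, mul_one]
  have hii : ∀ E : Set α, MeasurableSet E → Integrable (E.indicator fun _ => (1 : ℝ)) μ :=
    fun E hE => (integrable_const _).indicator hE
  rw [hi E hE, hi G hG, ← integral_const_mul, ← integral_const_mul,
    ← integral_add (hf.const_mul 2) ((hii G hG).const_mul 3)]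
  refine integral_mono (hii E hE) ((hf.const_mul 2).add ((hii G hG).const_mul 3)) fun z => ?_
  by_cases hzG : z ∈ G
  · have := h3 z hzG
    by_cases hzE : z ∈ E
    · simp [hzE, hzG]; linarith
    · simp [hzE, hzG]; linarith
  · have := h1 z hzG
    by_cases hzE : z ∈ E
    · have := h2 z hzE hzG
      simp [hzE, hzG]; linarith
    · simp [hzE, hzG]; linarith

lemma integrable_of_abs_le {μ : Measure (Fin d → ℝ)} [IsFiniteMeasure μ] {f : (Fin d → ℝ) → ℝ}
    (hf : Continuous f) {C : ℝ} (h : ∀ z, |f z| ≤ C) : Integrable f μ :=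
  Integrable.of_bound hf.aestronglyMeasurable C (Eventually.of_forall h)

/-- Tail of a lower functional under the boundary measure `ν k`. -/
lemma IsBARSolution.boundary_tail_le (htri : ∀ i j : Fin d, i < j → R i j = 0) {k j : Fin d}
    (hjk : j < k) (hRk : 0 < R k k) {v : Fin d → ℝ} (hv : IsUk R j v) :
    ∃ C, 0 ≤ C ∧ ∀ {r : ℝ} {π : Measure (Fin d → ℝ)} {ν : Fin d → Measure (Fin d → ℝ)},
      IsBARSolution Γ R r π ν → ∀ A : ℝ, 1 ≤ A → ∀ ε : ℝ, 0 ≤ ε →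
      π.real (tailSet v A) ≤ ε → (∀ i < k, (ν i).real (tailSet v A) ≤ ε) →
      (ν k).real (tailSet v (2 * A)) ≤ C * (r ^ ((k : ℕ) + 1))⁻¹ * ε := by
  obtain ⟨g, g₁, g₂, B', hg⟩ := exists_isCutoff
  refine ⟨(R k k)⁻¹ * ((1 + 2 * d) * coeffBound Γ R (Pi.single k 1) v * (1 * B')), ?_, ?_⟩
  · have := hg.nonneg
    have := coeffBound_nonneg (Γ := Γ) (R := R) (Pi.single k 1) v
    positivity
  intro r π ν h A hA ε hε hπ hν
  have hA0 : 0 < A := by linarith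
  have := h.prob_boundary k
  have hr := h.pos
  have key := h.boundary_le (isBddC2_sin_div le_rfl) hg hA (a := Pi.single k 1) (b := v) (k := k)
    (by rw [hv.uR_eq htri, if_neg hjk.ne']) hε hπ (by
      intro i hik hi
      refine hν i (lt_of_le_of_ne ?_ hik)
      by_contra hlt
      rw [uR_single, hv.uR_eq htri, if_neg (hjk.trans (not_le.1 hlt)).ne'] at hi
      exact hi.elim (fun h => h (htri _ _ (not_le.1 hlt))) (fun h => h rfl))
  have e : ∫ z, Real.cos ((Pi.single k 1 : Fin d → ℝ) ⬝ᵥ z / 1) * g (v ⬝ᵥ z / A) ∂(ν k) =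
      ∫ z, g (v ⬝ᵥ z / A) ∂(ν k) := by
    refine integral_congr_ae ?_
    filter_upwards [h.ae_face k] with z hz
    simp [hz]
  rw [e, uR_single] at key
  have hcont : Continuous fun z : Fin d → ℝ => g (v ⬝ᵥ z / A) :=
    hg.continuous.comp ((continuous_dotProduct_left v).div_const A)
  have h1 : (ν k).real (tailSet v (2 * A)) ≤ ∫ z, g (v ⬝ᵥ z / A) ∂(ν k) := by
    have hm := measurableSet_tailSet v (2 * A)
    have : (ν k).real (tailSet v (2 * A)) =
        ∫ z, (tailSet v (2 * A)).indicator (fun _ => (1 : ℝ)) z ∂(ν k) := by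
      rw [integral_indicator_const _ hm, smul_eq_mul, mul_one]
    rw [this]
    refine integral_mono ((integrable_const _).indicator hm)
      (integrable_of_abs_le hcont fun z => hg.bound _) fun z => ?_
    by_cases hz : z ∈ tailSet v (2 * A)
    · have : g (v ⬝ᵥ z / A) = 1 := by
        refine hg.eq_one _ ?_
        rw [abs_div, abs_of_pos hA0, le_div_iff₀ hA0]
        exact hz
      simp [hz, this]
    · simp [hz, hg.nonneg']
  have h2 : R k k * ∫ z, g (v ⬝ᵥ z / A) ∂(ν k) ≤ |R k k * ∫ z, g (v ⬝ᵥ z / A) ∂(ν k)| :=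
    le_abs_self _
  have hrk : 0 < r ^ ((k : ℕ) + 1) := by positivity
  have h3 := (mul_le_mul_of_nonneg_left h2 hrk.le).trans key
  refine h1.trans ?_
  set I := ∫ z, g (v ⬝ᵥ z / A) ∂(ν k)
  calc I = (R k k)⁻¹ * (r ^ ((k : ℕ) + 1))⁻¹ * (r ^ ((k : ℕ) + 1) * (R k k * I)) := by field_simp
    _ ≤ (R k k)⁻¹ * (r ^ ((k : ℕ) + 1))⁻¹ * _ := mul_le_mul_of_nonneg_left h3 (by positivity)
    _ = _ := by ring

/-- Tail of a higher functional under the boundary measure `ν i`. -/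
lemma IsBARSolution.boundary_tail_le' (htri : ∀ i j : Fin d, i < j → R i j = 0) {k i : Fin d}
    (hik : i < k) (hRi : 0 < R i i) {v w : Fin d → ℝ} (hv : IsUk R i v) (hw : IsUk R k w) :
    ∃ C, 0 ≤ C ∧ ∀ {r : ℝ} {π : Measure (Fin d → ℝ)} {ν : Fin d → Measure (Fin d → ℝ)},
      IsBARSolution Γ R r π ν → ∀ A : ℝ, 1 ≤ A → ∀ L : ℝ, 1 ≤ L → ∀ ε : ℝ, 0 ≤ ε →
      π.real (tailSet w A) ≤ ε → (ν k).real (tailSet w A) ≤ ε →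
      (ν i).real (tailSet w (2 * A)) ≤
        C * (r ^ ((i : ℕ) + 1))⁻¹ * L * ε + 3 * (ν i).real (tailSet v L) := by
  obtain ⟨g, g₁, g₂, B', hg⟩ := exists_isCutoff
  refine ⟨2 * (R i i)⁻¹ * ((1 + 2 * d) * coeffBound Γ R v w * B'), ?_, ?_⟩
  · have := hg.nonneg
    have := coeffBound_nonneg (Γ := Γ) (R := R) v w
    positivity
  intro r π ν h A hA L hL ε hε hπ hν
  have hA0 : 0 < A := by linarith
  have := h.prob_boundary i
  have hr := h.pos
  have key := h.boundary_le (isBddC2_sin_div hL) hg hA (a := v) (b := w) (k := i)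
    (by rw [hw.uR_eq htri, if_neg hik.ne]) hε hπ (by
      intro l hl hl'
      rw [hv.uR_eq htri, if_neg hl, hw.uR_eq htri] at hl'
      by_cases hlk : l = k
      · rwa [hlk]
      · simp [hlk] at hl')
  have hcont : Continuous fun z : Fin d → ℝ => Real.cos (v ⬝ᵥ z / L) * g (w ⬝ᵥ z / A) :=
    (Real.continuous_cos.comp ((continuous_dotProduct_left v).div_const L)).mul
      (hg.continuous.comp ((continuous_dotProduct_left w).div_const A))
  have hb : ∀ z : Fin d → ℝ, |Real.cos (v ⬝ᵥ z / L) * g (w ⬝ᵥ z / A)| ≤ 1 := fun z => by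
    rw [abs_mul, abs_of_nonneg (hg.nonneg' _)]
    exact mul_le_one₀ (Real.abs_cos_le_one _) (hg.nonneg' _) (hg.le_one _)
  have h1 := measureReal_le_integral_add (integrable_of_abs_le (μ := ν i) hcont hb)
    (measurableSet_tailSet w (2 * A)) (measurableSet_tailSet v L)
    (fun z hz => mul_nonneg (by linarith [half_le_cos_div (not_le.1 hz)]) (hg.nonneg' _))
    (fun z hz hz' => by
      have : g (w ⬝ᵥ z / A) = 1 := by
        refine hg.eq_one _ ?_
        rw [abs_div, abs_of_pos hA0, le_div_iff₀ hA0]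
        exact hz
      rw [this, mul_one]
      exact half_le_cos_div (not_le.1 hz'))
    (fun z _ => (abs_le.1 (hb z)).1)
  refine h1.trans (add_le_add ?_ le_rfl)
  rw [hv.uR_eq htri, if_pos rfl] at key
  have h2 := le_abs_self (R i i * ∫ z, Real.cos (v ⬝ᵥ z / L) * g (w ⬝ᵥ z / A) ∂(ν i))
  have hrk : 0 < r ^ ((i : ℕ) + 1) := by positivity
  have h3 := (mul_le_mul_of_nonneg_left h2 hrk.le).trans key
  set I := ∫ z, Real.cos (v ⬝ᵥ z / L) * g (w ⬝ᵥ z / A) ∂(ν i)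
  calc 2 * I = 2 * (R i i)⁻¹ * (r ^ ((i : ℕ) + 1))⁻¹ * (r ^ ((i : ℕ) + 1) * (R i i * I)) := by
        field_simp
    _ ≤ 2 * (R i i)⁻¹ * (r ^ ((i : ℕ) + 1))⁻¹ * _ := mul_le_mul_of_nonneg_left h3 (by positivity)
    _ = _ := by ring

/-- Tail of `u_k ⬝ᵥ z` under the interior measure in terms of its tail at a lower level. -/
lemma IsBARSolution.interior_tail_le (htri : ∀ i j : Fin d, i < j → R i j = 0) {k : Fin d}
    (hRk : 0 < R k k) {w : Fin d → ℝ} (hw : IsUk R k w) :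
    ∃ C, 0 ≤ C ∧ ∀ {r : ℝ} {π : Measure (Fin d → ℝ)} {ν : Fin d → Measure (Fin d → ℝ)},
      IsBARSolution Γ R r π ν → ∀ A : ℝ, 1 ≤ A →
      π.real (tailSet w (2 * A)) ≤ C * ((ν k).real (tailSet w A) +
        (r ^ ((k : ℕ) + 1))⁻¹ / A * π.real (tailSet w A)) := by
  obtain ⟨g, g₁, g₂, B', hg⟩ := exists_isCutoff
  have hB' := hg.nonneg
  refine ⟨2 * ((1 + 2 * B') + |bilin Γ w w| / (2 * R k k) * (1 + 4 * B')), by positivity, ?_⟩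
  intro r π ν h A hA
  have hA0 : 0 < A := by linarith
  have := h.prob_boundary k
  have := h.prob
  have hr := h.pos
  have hrk : 0 < r ^ ((k : ℕ) + 1) := by positivity
  set a := (ν k).real (tailSet w A) with ha
  set b := π.real (tailSet w A) with hb
  have ha0 : 0 ≤ a := measureReal_nonneg
  have hb0 : 0 ≤ b := measureReal_nonneg
  have main : ∀ L : ℝ, 2 * A < L → π.real (tailSet w (2 * A)) ≤
      2 * ((1 + 2 * B') + |bilin Γ w w| / (2 * R k k) * (1 + 4 * B')) *
        (a + (r ^ ((k : ℕ) + 1))⁻¹ / A * b) + 3 * π.real (tailSet w L) := by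
    intro L hL
    have hL1 : 1 ≤ L := by linarith
    have hL0 : 0 < L := by linarith
    have key := h.bar.mul_ridge (isBddC2_sin_div hL1) (hg.div hA) w w
    rw [Finset.sum_eq_single k (by
      intro i _ hi
      simp [hw.uR_eq htri, hi]) (by simp), hw.uR_eq htri, if_pos rfl] at key
    set F : (Fin d → ℝ) → ℝ := fun z => Real.cos (w ⬝ᵥ z / L) * g (w ⬝ᵥ z / A) +
      L * Real.sin (w ⬝ᵥ z / L) * (g₁ (w ⬝ᵥ z / A) / A) with hF
    set F' : (Fin d → ℝ) → ℝ := fun z => -Real.sin (w ⬝ᵥ z / L) / L * g (w ⬝ᵥ z / A) +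
      2 * (Real.cos (w ⬝ᵥ z / L) * (g₁ (w ⬝ᵥ z / A) / A)) +
      L * Real.sin (w ⬝ᵥ z / L) * (g₂ (w ⬝ᵥ z / A) / A ^ 2) with hF'
    have e1 : ∀ μ : Measure (Fin d → ℝ),
        ∫ z, (R k k * (Real.cos (w ⬝ᵥ z / L) * g (w ⬝ᵥ z / A)) +
        R k k * (L * Real.sin (w ⬝ᵥ z / L) * (g₁ (w ⬝ᵥ z / A) / A))) ∂μ =
        R k k * ∫ z, F z ∂μ := by
      intro μ
      rw [← integral_const_mul]
      simp only [hF, mul_add]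
    have e2 : ∫ z, (bilin Γ w w * (-Real.sin (w ⬝ᵥ z / L) / L * g (w ⬝ᵥ z / A)) +
        (bilin Γ w w + bilin Γ w w) * (Real.cos (w ⬝ᵥ z / L) * (g₁ (w ⬝ᵥ z / A) / A)) +
        bilin Γ w w * (L * Real.sin (w ⬝ᵥ z / L) * (g₂ (w ⬝ᵥ z / A) / A ^ 2))) ∂π =
        bilin Γ w w * ∫ z, F' z ∂π := by
      rw [← integral_const_mul]
      refine integral_congr_ae (Eventually.of_forall fun z => ?_)
      simp only [hF']
      ring
    rw [e1, e1, e2] at key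
    have hout : ∀ z ∉ tailSet w A, |w ⬝ᵥ z / A| < 1 := by
      intro z hz
      rw [abs_div, abs_of_pos hA0, div_lt_one hA0]
      exact not_le.1 hz
    have hsin : ∀ x : ℝ, |L * Real.sin (x / L)| ≤ |x| := by
      intro x
      rw [abs_mul, abs_of_pos hL0]
      calc L * |Real.sin (x / L)| ≤ L * |x / L| :=
            mul_le_mul_of_nonneg_left Real.abs_sin_le_abs hL0.le
        _ = |x| := by rw [abs_div, abs_of_pos hL0]; field_simp
    have hloc : ∀ f : ℝ → ℝ, (∀ x, |f x| ≤ B') → (∀ x, 2 < |x| → f x = 0) →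
        ∀ y : ℝ, |L * Real.sin (y / L) * (f (y / A) / A)| ≤ 2 * B' := by
      intro f hf hf' y
      by_cases hy : 2 < |y / A|
      · rw [hf' _ hy]
        simpa using hB'
      · have hyA : |y| ≤ 2 * A := by
          rw [not_lt, abs_div, abs_of_pos hA0, div_le_iff₀ hA0] at hy
          exact hy
        rw [abs_mul, abs_div, abs_of_pos hA0]
        calc |L * Real.sin (y / L)| * (|f (y / A)| / A) ≤ (2 * A) * (B' / A) := by
              gcongr
              · exact (hsin y).trans hyA
              · exact hf _
          _ = 2 * B' := by field_simp
    have hFb : ∀ z, |F z| ≤ 1 + 2 * B' := by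
      intro z
      refine (abs_add_le _ _).trans (add_le_add ?_ (hloc g₁ hg.bound₁ hg.eq_zero₁' _))
      rw [abs_mul, abs_of_nonneg (hg.nonneg' _)]
      exact mul_le_one₀ (Real.abs_cos_le_one _) (hg.nonneg' _) (hg.le_one _)
    have hF'b : ∀ z, |F' z| ≤ (1 + 4 * B') / A := by
      intro z
      have t1 : |-Real.sin (w ⬝ᵥ z / L) / L * g (w ⬝ᵥ z / A)| ≤ 1 / A := by
        rw [abs_mul, abs_of_nonneg (hg.nonneg' _), abs_div, abs_neg, abs_of_pos hL0]
        calc |Real.sin (w ⬝ᵥ z / L)| / L * g (w ⬝ᵥ z / A) ≤ 1 / A * 1 := by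
              gcongr
              · exact hg.nonneg' _
              · exact Real.abs_sin_le_one _
              · linarith
              · exact hg.le_one _
          _ = 1 / A := mul_one _
      have t2 : |2 * (Real.cos (w ⬝ᵥ z / L) * (g₁ (w ⬝ᵥ z / A) / A))| ≤ 2 * (1 * (B' / A)) := by
        rw [abs_mul, abs_mul, abs_div, abs_of_pos hA0, abs_two]
        gcongr
        · exact Real.abs_cos_le_one _
        · exact hg.bound₁ _
      have t3 : |L * Real.sin (w ⬝ᵥ z / L) * (g₂ (w ⬝ᵥ z / A) / A ^ 2)| ≤ 2 * B' / A := by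
        have := hloc g₂ hg.bound₂ hg.eq_zero₂' (w ⬝ᵥ z)
        have e : L * Real.sin (w ⬝ᵥ z / L) * (g₂ (w ⬝ᵥ z / A) / A ^ 2) =
            L * Real.sin (w ⬝ᵥ z / L) * (g₂ (w ⬝ᵥ z / A) / A) / A := by
          field_simp
        rw [e, abs_div, abs_of_pos hA0]
        gcongr
      refine (abs_add_le _ _).trans ((add_le_add ((abs_add_le _ _).trans
        (add_le_add t1 t2)) t3).trans (le_of_eq ?_))
      ring
    have hFz : ∀ z ∉ tailSet w A, F z = 0 := fun z hz => by
      simp [hF, hg.eq_zero _ (hout z hz), hg.eq_zero₁ _ (hout z hz)]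
    have hF'z : ∀ z ∉ tailSet w A, F' z = 0 := fun z hz => by
      simp [hF', hg.eq_zero _ (hout z hz), hg.eq_zero₁ _ (hout z hz), hg.eq_zero₂ _ (hout z hz)]
    have i1 : |∫ z, F z ∂(ν k)| ≤ (1 + 2 * B') * a :=
      abs_integral_le_mul_measureReal (measurableSet_tailSet w A) (fun z _ => hFb z) hFz
    have i2 : |∫ z, F' z ∂π| ≤ (1 + 4 * B') / A * b :=
      abs_integral_le_mul_measureReal (measurableSet_tailSet w A) (fun z _ => hF'b z) hF'z
    have hFc : Continuous F := by
      have c0 := continuous_dotProduct_left w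
      have c1 := hg.continuous
      have c2 := hg.continuous₁
      fun_prop
    have hFin : ∀ z ∉ tailSet w L, Real.cos (w ⬝ᵥ z / L) * g (w ⬝ᵥ z / A) ≤ F z := by
      intro z hz
      have hzL : |w ⬝ᵥ z| < L := not_le.1 hz
      refine le_add_of_nonneg_right ?_
      have h1 := hg.mul_nonneg₁ (w ⬝ᵥ z / A)
      have h2 : |w ⬝ᵥ z / L| ≤ Real.pi := by
        rw [abs_div, abs_of_pos hL0, div_le_iff₀ hL0]
        nlinarith [Real.pi_gt_three]
      rcases lt_trichotomy (w ⬝ᵥ z) 0 with h0 | h0 | h0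
      · have h3 : w ⬝ᵥ z / A < 0 := div_neg_of_neg_of_pos h0 hA0
        have h4 : g₁ (w ⬝ᵥ z / A) ≤ 0 := by
          by_contra hc
          exact absurd h1 (not_le.2 (mul_neg_of_neg_of_pos h3 (not_le.1 hc)))
        have h5 := Real.sin_nonpos_of_nonpos_of_neg_pi_le
          (div_nonpos_of_nonpos_of_nonneg h0.le hL0.le) (abs_le.1 h2).1
        exact mul_nonneg_of_nonpos_of_nonpos (mul_nonpos_of_nonneg_of_nonpos hL0.le h5)
          (div_nonpos_of_nonpos_of_nonneg h4 hA0.le)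
      · simp [h0]
      · have h3 : 0 < w ⬝ᵥ z / A := div_pos h0 hA0
        have h4 : 0 ≤ g₁ (w ⬝ᵥ z / A) := nonneg_of_mul_nonneg_right h1 h3
        have h5 := Real.sin_nonneg_of_nonneg_of_le_pi (div_pos h0 hL0).le (abs_le.1 h2).2
        positivity
    have hone : ∀ z ∈ tailSet w (2 * A), g (w ⬝ᵥ z / A) = 1 := by
      intro z hz
      refine hg.eq_one _ ?_
      rw [abs_div, abs_of_pos hA0, le_div_iff₀ hA0]
      exact hz
    have i3 := measureReal_le_integral_add (integrable_of_abs_le (μ := π) hFc hFb)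
      (measurableSet_tailSet w (2 * A)) (measurableSet_tailSet w L)
      (fun z hz => (mul_nonneg (by linarith [half_le_cos_div (not_le.1 hz)])
        (hg.nonneg' _)).trans (hFin z hz))
      (fun z hz hzL => by
        refine le_trans ?_ (hFin z hzL)
        rw [hone z hz, mul_one]
        exact half_le_cos_div (not_le.1 hzL))
      (fun z hz => by
        have hzL : L ≤ |w ⬝ᵥ z| := hz
        have h2 : 2 < |w ⬝ᵥ z / A| := by
          rw [abs_div, abs_of_pos hA0, lt_div_iff₀ hA0]
          linarith
        have h3 : F z = Real.cos (w ⬝ᵥ z / L) := by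
          simp only [hF]
          rw [hg.eq_zero₁' _ h2, hg.eq_one _ h2.le]
          simp
        rw [h3]
        exact Real.neg_one_le_cos _)
    have e3 : ∫ z, F z ∂π = ∫ z, F z ∂(ν k) +
        bilin Γ w w / (2 * R k k) * (r ^ ((k : ℕ) + 1))⁻¹ * ∫ z, F' z ∂π := by
      field_simp
      linarith
    have i4 : bilin Γ w w / (2 * R k k) * (r ^ ((k : ℕ) + 1))⁻¹ * ∫ z, F' z ∂π ≤
        |bilin Γ w w| / (2 * R k k) * (1 + 4 * B') * ((r ^ ((k : ℕ) + 1))⁻¹ / A * b) := by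
      refine (le_abs_self _).trans ?_
      rw [abs_mul, abs_mul, abs_div, abs_of_pos (inv_pos.2 hrk),
        abs_of_pos (mul_pos two_pos hRk)]
      calc |bilin Γ w w| / (2 * R k k) * (r ^ ((k : ℕ) + 1))⁻¹ * |∫ z, F' z ∂π| ≤
          |bilin Γ w w| / (2 * R k k) * (r ^ ((k : ℕ) + 1))⁻¹ * ((1 + 4 * B') / A * b) := by
            gcongr
        _ = _ := by ring
    have hQ : 0 ≤ |bilin Γ w w| / (2 * R k k) * (1 + 4 * B') := by positivity
    have hX : 0 ≤ (r ^ ((k : ℕ) + 1))⁻¹ / A * b := by positivity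
    have i5 := (le_abs_self _).trans i1
    rw [e3] at i3
    nlinarith [mul_nonneg hQ ha0, mul_nonneg (show 0 ≤ 1 + 2 * B' by positivity) hX]
  have hlim := ((tendsto_measureReal_tailSet π w).const_mul 3).const_add
    (2 * ((1 + 2 * B') + |bilin Γ w w| / (2 * R k k) * (1 + 4 * B')) *
        (a + (r ^ ((k : ℕ) + 1))⁻¹ / A * b))
  rw [mul_zero, add_zero] at hlim
  refine ge_of_tendsto hlim ?_
  filter_upwards [tendsto_natCast_atTop_atTop.eventually_gt_atTop (2 * A)] with n hn
  exact main n hn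

end

section

variable {d : ℕ} {Γ R : Matrix (Fin d) (Fin d) ℝ}

/-- Under `μ t` the functional `v ⬝ᵥ z` is of order `t ^ (-s)`, up to events whose probability
decreases faster than any power of `t`. -/
def HasTail (μ : ℝ → Measure (Fin d → ℝ)) (s : ℕ) (v : Fin d → ℝ) : Prop :=
  ∀ N : ℕ, ∃ C : ℝ, 1 ≤ C ∧ ∀ t ∈ Set.Ioo (0 : ℝ) 1,
    (μ t).real (tailSet v (C * (t ^ s)⁻¹)) ≤ C * t ^ N

lemma tailSet_anti (v : Fin d → ℝ) {A A' : ℝ} (h : A ≤ A') : tailSet v A' ⊆ tailSet v A :=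
  fun _ hz => h.trans hz

lemma tail_le_of_le {μ : Measure (Fin d → ℝ)} [IsProbabilityMeasure μ] {v : Fin d → ℝ}
    {s s' N N' : ℕ} {C C' t : ℝ} (ht : t ∈ Set.Ioo (0 : ℝ) 1) (hC : 1 ≤ C) (hCC : C ≤ C')
    (hs : s ≤ s') (hN : N' ≤ N) (h : μ.real (tailSet v (C * (t ^ s)⁻¹)) ≤ C * t ^ N) :
    μ.real (tailSet v (C' * (t ^ s')⁻¹)) ≤ C' * t ^ N' := by
  have ht0 := ht.1
  refine (measureReal_mono (tailSet_anti v ?_)).trans (h.trans ?_)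
  · refine mul_le_mul hCC ?_ (by positivity) (by linarith)
    exact inv_anti₀ (by positivity) (pow_le_pow_of_le_one ht.1.le ht.2.le hs)
  · exact mul_le_mul hCC (pow_le_pow_of_le_one ht.1.le ht.2.le hN) (by positivity) (by linarith)

/-- `μ t` is a probability measure for every `t ∈ (0, 1)`. -/
def IsProbFamily (μ : ℝ → Measure (Fin d → ℝ)) : Prop :=
  ∀ t ∈ Set.Ioo (0 : ℝ) 1, IsProbabilityMeasure (μ t)

lemma HasTail.mono {μ : ℝ → Measure (Fin d → ℝ)} (hμ : IsProbFamily μ) {s s' : ℕ}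
    {v : Fin d → ℝ} (h : HasTail μ s v) (hs : s ≤ s') : HasTail μ s' v := by
  intro N
  obtain ⟨C, hC, h⟩ := h N
  refine ⟨C, hC, fun t ht => ?_⟩
  have := hμ t ht
  exact tail_le_of_le ht hC le_rfl hs le_rfl (h t ht)

lemma hasTail_zero (μ : ℝ → Measure (Fin d → ℝ)) (s : ℕ) : HasTail μ s 0 := by
  intro N
  refine ⟨1, le_rfl, fun t ht => ?_⟩
  have ht0 := ht.1
  have : tailSet (0 : Fin d → ℝ) (1 * (t ^ s)⁻¹) = ∅ := by
    refine Set.eq_empty_of_forall_notMem fun z hz => ?_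
    have : 1 * (t ^ s)⁻¹ ≤ |(0 : Fin d → ℝ) ⬝ᵥ z| := hz
    rw [zero_dotProduct, abs_zero] at this
    have : 0 < 1 * (t ^ s)⁻¹ := by positivity
    linarith
  rw [this, measureReal_empty]
  positivity

lemma HasTail.add {μ : ℝ → Measure (Fin d → ℝ)} (hμ : IsProbFamily μ) {s : ℕ}
    {v w : Fin d → ℝ} (hv : HasTail μ s v) (hw : HasTail μ s w) : HasTail μ s (v + w) := by
  intro N
  obtain ⟨C, hC, hv⟩ := hv N
  obtain ⟨D, hD, hw⟩ := hw N
  refine ⟨C + D, by linarith, fun t ht => ?_⟩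
  have := hμ t ht
  have hsub : tailSet (v + w) ((C + D) * (t ^ s)⁻¹) ⊆
      tailSet v (C * (t ^ s)⁻¹) ∪ tailSet w (D * (t ^ s)⁻¹) := by
    intro z hz
    by_contra hc
    rw [Set.mem_union, not_or] at hc
    have h1 : |v ⬝ᵥ z| < C * (t ^ s)⁻¹ := not_le.1 hc.1
    have h2 : |w ⬝ᵥ z| < D * (t ^ s)⁻¹ := not_le.1 hc.2
    have h3 : (C + D) * (t ^ s)⁻¹ ≤ |(v + w) ⬝ᵥ z| := hz
    rw [add_dotProduct] at h3
    have := abs_add_le (v ⬝ᵥ z) (w ⬝ᵥ z)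
    linarith
  refine (measureReal_mono hsub).trans ((measureReal_union_le _ _).trans ?_)
  have h1 := hv t ht
  have h2 := hw t ht
  linarith

lemma HasTail.smul {μ : ℝ → Measure (Fin d → ℝ)} (hμ : IsProbFamily μ) {s : ℕ}
    {v : Fin d → ℝ} (hv : HasTail μ s v) (c : ℝ) : HasTail μ s (c • v) := by
  intro N
  obtain ⟨C, hC, hv⟩ := hv N
  refine ⟨(1 + |c|) * C, by nlinarith [abs_nonneg c], fun t ht => ?_⟩
  have ht0 := ht.1
  have := hμ t ht
  have hCs : 0 < C * (t ^ s)⁻¹ := by positivity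
  have hsub : tailSet (c • v) ((1 + |c|) * C * (t ^ s)⁻¹) ⊆ tailSet v (C * (t ^ s)⁻¹) := by
    intro z hz
    have h3 : (1 + |c|) * C * (t ^ s)⁻¹ ≤ |(c • v) ⬝ᵥ z| := hz
    by_contra hc
    have h1 : |v ⬝ᵥ z| < C * (t ^ s)⁻¹ := not_le.1 hc
    rw [smul_dotProduct, smul_eq_mul, abs_mul] at h3
    nlinarith [abs_nonneg c, abs_nonneg (v ⬝ᵥ z)]
  refine (measureReal_mono hsub).trans ((hv t ht).trans ?_)
  have : 0 < C * t ^ N := by positivity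
  nlinarith [abs_nonneg c]

lemma HasTail.sum {μ : ℝ → Measure (Fin d → ℝ)} (hμ : IsProbFamily μ) {s : ℕ} {ι : Type*}
    (S : Finset ι) {v : ι → Fin d → ℝ} (h : ∀ i ∈ S, HasTail μ s (v i)) :
    HasTail μ s (∑ i ∈ S, v i) :=
  Finset.sum_induction _ (HasTail μ s) (fun _ _ => HasTail.add hμ) (hasTail_zero μ s) h

lemma HasTail.congr {μ : ℝ → Measure (Fin d → ℝ)} {s : ℕ} {v w : Fin d → ℝ}
    (h : HasTail μ s v) (hvw : ∀ t ∈ Set.Ioo (0 : ℝ) 1, ∀ᵐ z ∂(μ t), v ⬝ᵥ z = w ⬝ᵥ z) :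
    HasTail μ s w := by
  intro N
  obtain ⟨C, hC, h⟩ := h N
  refine ⟨C, hC, fun t ht => ?_⟩
  rw [← measureReal_congr (s := tailSet v (C * (t ^ s)⁻¹)) (by
    filter_upwards [hvw t ht] with z hz
    refine propext ?_
    show C * (t ^ s)⁻¹ ≤ |v ⬝ᵥ z| ↔ C * (t ^ s)⁻¹ ≤ |w ⬝ᵥ z|
    rw [hz])]
  exact h t ht

lemma HasTail.exists_common {ι : Type*} [Fintype ι] {μ : ι → ℝ → Measure (Fin d → ℝ)}
    (hμ : ∀ i, IsProbFamily (μ i)) {s : ℕ} {v : Fin d → ℝ} (h : ∀ i, HasTail (μ i) s v) (N : ℕ) :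
    ∃ C : ℝ, 1 ≤ C ∧ ∀ i, ∀ t ∈ Set.Ioo (0 : ℝ) 1,
      (μ i t).real (tailSet v (C * (t ^ s)⁻¹)) ≤ C * t ^ N := by
  choose C hC h using fun i => h i N
  have hle : ∀ i, C i ≤ 1 + ∑ j, C j := fun i => by
    have := Finset.single_le_sum (f := C) (fun j _ => zero_le_one.trans (hC j)) (Finset.mem_univ i)
    linarith
  refine ⟨1 + ∑ j, C j, ?_, fun i t ht => ?_⟩
  · have := Finset.sum_nonneg (s := Finset.univ) fun j _ => zero_le_one.trans (hC j)
    linarith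
  · have := hμ i t ht
    exact tail_le_of_le ht (hC i) (hle i) le_rfl le_rfl (h i t ht)

/-- Each coordinate is a combination of the functionals `u_l`. -/
lemma hasTail_single {μ : ℝ → Measure (Fin d → ℝ)} (hμ : IsProbFamily μ)
    {u : Fin d → Fin d → ℝ} (hu : ∀ k, IsUk R k (u k)) {j : Fin d}
    (h : ∀ l ≤ j, HasTail μ (4 * (l : ℕ) + 5) (u l)) :
    HasTail μ (4 * (j : ℕ) + 5) (Pi.single j 1) := by
  induction j using WellFoundedLT.induction with
  | ind j ih =>
    have e : (Pi.single j 1 : Fin d → ℝ) =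
        u j + ∑ l ∈ Finset.univ.filter (· < j), (-u j l) • (Pi.single l 1 : Fin d → ℝ) := by
      ext i
      simp only [Pi.add_apply, Finset.sum_apply, Pi.smul_apply, smul_eq_mul, Pi.single_apply,
        mul_ite, mul_one, mul_zero, Finset.sum_ite_eq, Finset.mem_filter, Finset.mem_univ, true_and]
      rcases lt_trichotomy i j with hi | rfl | hi
      · simp [hi, hi.ne]
      · simp [(hu i).1]
      · simp [hi.ne', hi.not_gt, (hu j).2.1 i hi]
    rw [e]
    refine (h j le_rfl).add hμ (HasTail.sum hμ _ fun l hl => ?_)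
    have hl := (Finset.mem_filter.1 hl).2
    exact ((ih l hl fun m hm => h m (hm.trans hl.le)).mono hμ
      (by have : (l : ℕ) < j := hl
          omega)).smul hμ _

section Induction

variable {π : ℝ → Measure (Fin d → ℝ)} {ν : Fin d → ℝ → Measure (Fin d → ℝ)}

/-- A family of solutions of the basic adjoint relationship, with `r = t ^ 4`. -/
def IsBARSolutionFamily (Γ R : Matrix (Fin d) (Fin d) ℝ) (π : ℝ → Measure (Fin d → ℝ))
    (ν : Fin d → ℝ → Measure (Fin d → ℝ)) : Prop :=
  ∀ t ∈ Set.Ioo (0 : ℝ) 1, IsBARSolution Γ R (t ^ 4) (π t) (fun i => ν i t)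

lemma IsBARSolutionFamily.prob (h : IsBARSolutionFamily Γ R π ν) : IsProbFamily π :=
  fun t ht => (h t ht).prob

lemma IsBARSolutionFamily.prob_boundary (h : IsBARSolutionFamily Γ R π ν) (i : Fin d) :
    IsProbFamily (ν i) :=
  fun t ht => (h t ht).prob_boundary i

lemma one_le_scale {C t : ℝ} (hC : 1 ≤ C) (ht : t ∈ Set.Ioo (0 : ℝ) 1) (s : ℕ) :
    1 ≤ C * (t ^ s)⁻¹ :=
  one_le_mul_of_one_le_of_one_le hC
    ((one_le_inv₀ (pow_pos ht.1 s)).2 (pow_le_one₀ ht.1.le ht.2.le))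

/-- The lower functionals under `ν k`. -/
lemma IsBARSolutionFamily.hasTail_boundary (h : IsBARSolutionFamily Γ R π ν)
    (htri : ∀ i j : Fin d, i < j → R i j = 0) {k j : Fin d} (hjk : j < k) (hRk : 0 < R k k)
    {v : Fin d → ℝ} (hv : IsUk R j v) {s : ℕ} (hπ : HasTail π s v)
    (hν : ∀ i < k, HasTail (ν i) s v) : HasTail (ν k) s v := by
  intro N
  obtain ⟨C, hC0, hC⟩ := IsBARSolution.boundary_tail_le (Γ := Γ) htri hjk hRk hv
  obtain ⟨D₁, hD₁, hπ⟩ := hπ (N + 4 * (k + 1))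
  obtain ⟨D₂, hD₂, hν⟩ := HasTail.exists_common (ι := {i // i < k}) (μ := fun i => ν i)
    (fun i => h.prob_boundary i) (fun i => hν i i.2) (N + 4 * (k + 1))
  set D := D₁ + D₂ with hD
  refine ⟨2 * D + C * D, by nlinarith, fun t ht => ?_⟩
  have ht0 := ht.1
  have := h.prob t ht
  have := fun i => h.prob_boundary i t ht
  have key := hC (h t ht) (D * (t ^ s)⁻¹) (one_le_scale (by linarith) ht s)
    (D * t ^ (N + 4 * (k + 1))) (by positivity)
    (tail_le_of_le ht hD₁ (by linarith) le_rfl le_rfl (hπ t ht))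
    (fun i hi => tail_le_of_le ht hD₂ (by linarith) le_rfl le_rfl (hν ⟨i, hi⟩ t ht))
  have e : C * ((t ^ 4) ^ ((k : ℕ) + 1))⁻¹ * (D * t ^ (N + 4 * (k + 1))) = C * D * t ^ N := by
    rw [← pow_mul, pow_add]
    field_simp
  rw [e, ← mul_assoc] at key
  have hD0 : 0 ≤ D := by linarith
  refine (measureReal_mono (tailSet_anti v ?_)).trans (key.trans ?_)
  · gcongr
    nlinarith
  · gcongr
    nlinarith

/-- The functional `u_k` under the interior measure. -/
lemma IsBARSolutionFamily.hasTail_interior (h : IsBARSolutionFamily Γ R π ν)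
    (htri : ∀ i j : Fin d, i < j → R i j = 0) {k : Fin d} (hRk : 0 < R k k)
    {w : Fin d → ℝ} (hw : IsUk R k w) (hν : HasTail (ν k) (4 * (k : ℕ) + 5) w) :
    HasTail π (4 * (k : ℕ) + 5) w := by
  intro N
  obtain ⟨C, hC0, hC⟩ := IsBARSolution.interior_tail_le (Γ := Γ) htri hRk hw
  obtain ⟨D, hD, hν⟩ := hν N
  have claim : ∀ n ≤ N, ∃ K : ℝ, 0 ≤ K ∧ ∀ t ∈ Set.Ioo (0 : ℝ) 1,
      (π t).real (tailSet w (2 ^ n * D * (t ^ (4 * (k : ℕ) + 5))⁻¹)) ≤ K * t ^ n := by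
    intro n
    induction n with
    | zero =>
      refine fun _ => ⟨1, zero_le_one, fun t ht => ?_⟩
      have := h.prob t ht
      simp
    | succ n ih =>
      intro hn
      obtain ⟨K, hK, ih⟩ := ih (by omega)
      refine ⟨C * (D + K), by positivity, fun t ht => ?_⟩
      have ht0 := ht.1
      have := h.prob_boundary k t ht
      have h2 : (1 : ℝ) ≤ 2 ^ n := one_le_pow₀ one_le_two
      have hs : 1 ≤ 2 ^ n * D := by nlinarith
      have key := hC (h t ht) _ (one_le_scale hs ht (4 * (k : ℕ) + 5))
      rw [← mul_assoc, ← mul_assoc, ← pow_succ'] at key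
      have i1 : (ν k t).real (tailSet w (2 ^ n * D * (t ^ (4 * (k : ℕ) + 5))⁻¹)) ≤
          D * t ^ (n + 1) := by
        refine (measureReal_mono (tailSet_anti w ?_)).trans ((hν t ht).trans ?_)
        · gcongr
          nlinarith
        · gcongr ?_ * ?_
          exact pow_le_pow_of_le_one ht.1.le ht.2.le hn
      have i2 : ((t ^ 4) ^ ((k : ℕ) + 1))⁻¹ / (2 ^ n * D * (t ^ (4 * (k : ℕ) + 5))⁻¹) ≤ t := by
        have e : ((t ^ 4) ^ ((k : ℕ) + 1))⁻¹ / (2 ^ n * D * (t ^ (4 * (k : ℕ) + 5))⁻¹) =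
            t / (2 ^ n * D) := by
          rw [← pow_mul, show 4 * (k : ℕ) + 5 = 4 * (k + 1) + 1 by ring, pow_succ]
          field_simp
        rw [e]
        exact div_le_self ht0.le hs
      refine key.trans ?_
      rw [mul_assoc C]
      refine mul_le_mul_of_nonneg_left ?_ hC0
      have i3 := mul_le_mul i2 (ih t ht) measureReal_nonneg ht0.le
      rw [add_mul]
      refine add_le_add i1 (i3.trans (le_of_eq ?_))
      ring
  obtain ⟨K, hK, hc⟩ := claim N le_rfl
  have h2 : (1 : ℝ) ≤ 2 ^ N := one_le_pow₀ one_le_two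
  refine ⟨2 ^ N * D + K, by nlinarith, fun t ht => ?_⟩
  have ht0 := ht.1
  have := h.prob t ht
  refine (measureReal_mono (tailSet_anti w ?_)).trans ((hc t ht).trans ?_)
  · gcongr
    linarith
  · gcongr
    nlinarith

/-- The functional `u_k` under the lower boundary measures. -/
lemma IsBARSolutionFamily.hasTail_boundary' (h : IsBARSolutionFamily Γ R π ν)
    (htri : ∀ i j : Fin d, i < j → R i j = 0) {k i : Fin d} (hik : i < k) (hRi : 0 < R i i)
    {v w : Fin d → ℝ} (hv : IsUk R i v) (hw : IsUk R k w) {s s' : ℕ} (hπ : HasTail π s w)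
    (hνk : HasTail (ν k) s w) (hνi : HasTail (ν i) s' v) : HasTail (ν i) s w := by
  intro N
  obtain ⟨C, hC0, hC⟩ := IsBARSolution.boundary_tail_le' (Γ := Γ) htri hik hRi hv hw
  set M := N + s' + 4 * ((i : ℕ) + 1) with hM
  obtain ⟨D₁, hD₁, hπ⟩ := hπ M
  obtain ⟨D₂, hD₂, hνk⟩ := hνk M
  obtain ⟨E, hE, hνi⟩ := hνi N
  set D := D₁ + D₂ with hD
  refine ⟨2 * D + (C * E * D + 3 * E), ?_, fun t ht => ?_⟩
  · have : 0 ≤ C * E * D := by positivity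
    linarith
  have ht0 := ht.1
  have := h.prob t ht
  have := fun i => h.prob_boundary i t ht
  have key := hC (h t ht) (D * (t ^ s)⁻¹) (one_le_scale (by linarith) ht s)
    (E * (t ^ s')⁻¹) (one_le_scale hE ht s') (D * t ^ M) (by positivity)
    (tail_le_of_le ht hD₁ (by linarith) le_rfl le_rfl (hπ t ht))
    (tail_le_of_le ht hD₂ (by linarith) le_rfl le_rfl (hνk t ht))
  have e : C * ((t ^ 4) ^ ((i : ℕ) + 1))⁻¹ * (E * (t ^ s')⁻¹) * (D * t ^ M) =
      C * E * D * t ^ N := by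
    rw [hM, ← pow_mul, pow_add, pow_add]
    field_simp
  rw [e, ← mul_assoc] at key
  have hi := hνi t ht
  have hD0 : 0 ≤ D := by linarith
  have hCED : 0 ≤ C * E * D := by positivity
  refine (measureReal_mono (tailSet_anti w ?_)).trans (key.trans ?_)
  · gcongr
    linarith
  · have : 0 < t ^ N := by positivity
    nlinarith [mul_nonneg hD0 this.le]

/-- Under `ν k`, the coordinate `z k` vanishes, so `u_k ⬝ᵥ z` only involves lower coordinates. -/
lemma IsBARSolutionFamily.hasTail_boundary_self (h : IsBARSolutionFamily Γ R π ν)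
    {u : Fin d → Fin d → ℝ} (hu : ∀ k, IsUk R k (u k)) {k : Fin d}
    (hν : ∀ l < k, HasTail (ν k) (4 * (l : ℕ) + 5) (u l)) :
    HasTail (ν k) (4 * (k : ℕ) + 1) (u k) := by
  have hp := h.prob_boundary k
  have hs : HasTail (ν k) (4 * (k : ℕ) + 1)
      (∑ l ∈ Finset.univ.filter (· < k), u k l • (Pi.single l 1 : Fin d → ℝ)) := by
    refine HasTail.sum hp _ fun l hl => ?_
    have hl := (Finset.mem_filter.1 hl).2
    exact ((hasTail_single hp hu fun m hm => hν m (hm.trans_lt hl)).mono hp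
      (by have : (l : ℕ) < k := hl
          omega)).smul hp _
  refine hs.congr fun t ht => ?_
  filter_upwards [(h t ht).ae_face k] with z hz
  rw [sum_dotProduct, Finset.sum_filter]
  refine Finset.sum_congr rfl fun l _ => ?_
  rcases lt_trichotomy l k with hl | rfl | hl
  · simp [hl]
  · simp [hz]
  · simp [hl.not_gt, (hu k).2.1 l hl]

/-- Tail bounds for all the functionals `u_l` under all the measures. -/
theorem IsBARSolutionFamily.hasTail (h : IsBARSolutionFamily Γ R π ν)
    (htri : ∀ i j : Fin d, i < j → R i j = 0) (hR : IsPMatrix R)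
    {u : Fin d → Fin d → ℝ} (hu : ∀ k, IsUk R k (u k)) (l : Fin d) :
    HasTail π (4 * (l : ℕ) + 5) (u l) ∧ ∀ i, HasTail (ν i) (4 * (l : ℕ) + 5) (u l) := by
  have claim : ∀ n : ℕ, ∀ l : Fin d, (l : ℕ) < n → HasTail π (4 * (l : ℕ) + 5) (u l) ∧
      ∀ i : Fin d, (i : ℕ) < n → HasTail (ν i) (4 * (l : ℕ) + 5) (u l) := by
    intro n
    induction n with
    | zero => exact fun l hl => absurd hl (Nat.not_lt_zero _)
    | succ n ih =>
      by_cases hnd : n < d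
      · set k : Fin d := ⟨n, hnd⟩
        have h1 : ∀ l < k, HasTail (ν k) (4 * (l : ℕ) + 5) (u l) := fun l hl =>
          h.hasTail_boundary htri hl (hR.diag_pos k) (hu l) (ih l hl).1
            fun i hi => (ih l hl).2 i hi
        have h2 : HasTail (ν k) (4 * (k : ℕ) + 5) (u k) :=
          (h.hasTail_boundary_self hu h1).mono (h.prob_boundary k) (by omega)
        have h3 := h.hasTail_interior htri (hR.diag_pos k) (hu k) h2
        have h4 : ∀ i < k, HasTail (ν i) (4 * (k : ℕ) + 5) (u k) := fun i hi =>
          h.hasTail_boundary' htri hi (hR.diag_pos i) (hu i) (hu k) h3 h2 ((ih i hi).2 i hi)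
        have hlt : ∀ i : Fin d, (i : ℕ) < n + 1 → i < k ∨ i = k := fun i hi =>
          lt_or_eq_of_le (show i ≤ k from Nat.lt_succ_iff.1 hi)
        intro l hl
        rcases hlt l hl with hl | rfl
        · refine ⟨(ih l hl).1, fun i hi => ?_⟩
          rcases hlt i hi with hi | rfl
          · exact (ih l hl).2 i hi
          · exact h1 l hl
        · refine ⟨h3, fun i hi => ?_⟩
          rcases hlt i hi with hi | rfl
          · exact h4 i hi
          · exact h2
      · exact fun l _ => ⟨(ih l (by omega)).1, fun i _ => (ih l (by omega)).2 i (by omega)⟩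
  exact ⟨(claim d l l.2).1, fun i => (claim d l l.2).2 i i.2⟩

end Induction

end

section

variable {d : ℕ} {Γ R : Matrix (Fin d) (Fin d) ℝ}

/-- The characteristic function of `μ` at `θ`. -/
def cf (μ : Measure (Fin d → ℝ)) (θ : Fin d → ℝ) : ℂ :=
  ∫ z, Complex.exp (((θ ⬝ᵥ z : ℝ) : ℂ) * Complex.I) ∂μ

lemma continuous_exp_dotProduct (θ : Fin d → ℝ) :
    Continuous fun z : Fin d → ℝ => Complex.exp (((θ ⬝ᵥ z : ℝ) : ℂ) * Complex.I) := by
  have := continuous_dotProduct_left θ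
  fun_prop

lemma integrable_exp_dotProduct (μ : Measure (Fin d → ℝ)) [IsFiniteMeasure μ] (θ : Fin d → ℝ) :
    Integrable (fun z : Fin d → ℝ => Complex.exp (((θ ⬝ᵥ z : ℝ) : ℂ) * Complex.I)) μ :=
  Integrable.of_bound (continuous_exp_dotProduct θ).aestronglyMeasurable 1
    (Eventually.of_forall fun _ => (Complex.norm_exp_ofReal_mul_I _).le)

lemma norm_cf_le_one (μ : Measure (Fin d → ℝ)) [IsProbabilityMeasure μ] (θ : Fin d → ℝ) :
    ‖cf μ θ‖ ≤ 1 := by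
  refine (norm_integral_le_of_norm_le_const
    (Eventually.of_forall fun _ => (Complex.norm_exp_ofReal_mul_I _).le)).trans ?_
  simp

lemma cf_zero (μ : Measure (Fin d → ℝ)) [IsProbabilityMeasure μ] : cf μ 0 = 1 := by
  simp [cf]

lemma cf_eq (μ : Measure (Fin d → ℝ)) [IsFiniteMeasure μ] (θ : Fin d → ℝ) :
    cf μ θ = (∫ z, Real.cos (θ ⬝ᵥ z) ∂μ : ℝ) + (∫ z, Real.sin (θ ⬝ᵥ z) ∂μ : ℝ) * Complex.I := by
  have h := continuous_dotProduct_left θ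
  have hc : Integrable (fun z : Fin d → ℝ => Real.cos (θ ⬝ᵥ z)) μ :=
    integrable_of_abs_le (Real.continuous_cos.comp h) fun _ => Real.abs_cos_le_one _
  have hs : Integrable (fun z : Fin d → ℝ => Real.sin (θ ⬝ᵥ z)) μ :=
    integrable_of_abs_le (Real.continuous_sin.comp h) fun _ => Real.abs_sin_le_one _
  rw [cf, ← integral_complex_ofReal, ← integral_complex_ofReal, ← integral_mul_const,
    ← integral_add hc.ofReal (hs.ofReal.mul_const _)]
  refine integral_congr_ae (Eventually.of_forall fun z => ?_)
  simp [Complex.exp_mul_I]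

lemma isBddC2_cos : IsBddC2 Real.cos (fun x => -Real.sin x) (fun x => -Real.cos x) 1 where
  hasDerivAt := Real.hasDerivAt_cos
  hasDerivAt' x := (Real.hasDerivAt_sin x).neg
  continuous₂ := Real.continuous_cos.neg
  bound := Real.abs_cos_le_one
  bound₁ x := by rw [abs_neg]; exact Real.abs_sin_le_one x
  bound₂ x := by rw [abs_neg]; exact Real.abs_cos_le_one x

lemma isBddC2_sin : IsBddC2 Real.sin Real.cos (fun x => -Real.sin x) 1 where
  hasDerivAt := Real.hasDerivAt_sin
  hasDerivAt' := Real.hasDerivAt_cos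
  continuous₂ := Real.continuous_sin.neg
  bound := Real.abs_sin_le_one
  bound₁ := Real.abs_cos_le_one
  bound₂ x := by rw [abs_neg]; exact Real.abs_sin_le_one x

lemma isBddC2_one : IsBddC2 (fun _ => 1) (fun _ => 0) (fun _ => 0) 1 where
  hasDerivAt x := hasDerivAt_const x 1
  hasDerivAt' x := hasDerivAt_const x 0
  continuous₂ := continuous_const
  bound _ := by simp
  bound₁ _ := by simp
  bound₂ _ := by simp

/-- The basic adjoint relationship in Fourier form. -/
lemma IsBARSolution.cf_eq {r : ℝ} {π : Measure (Fin d → ℝ)} {ν : Fin d → Measure (Fin d → ℝ)}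
    (h : IsBARSolution Γ R r π ν) (θ : Fin d → ℝ) :
    (1 / 2 : ℂ) * bilin Γ θ θ * cf π θ =
      Complex.I * ∑ i : Fin d, ((r ^ ((i : ℕ) + 1) * uR R θ i : ℝ) : ℂ) * (cf (ν i) θ - cf π θ) := by
  have := h.prob
  have := h.prob_boundary
  have hc := h.bar.mul_ridge isBddC2_cos isBddC2_one θ 0
  have hs := h.bar.mul_ridge isBddC2_sin isBddC2_one θ 0
  simp only [mul_one, mul_zero, add_zero, integral_const_mul, integral_neg] at hc hs
  simp only [SRBMPaper.cf_eq]
  set Cπ := ∫ z, Real.cos (θ ⬝ᵥ z) ∂π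
  set Sπ := ∫ z, Real.sin (θ ⬝ᵥ z) ∂π
  set Cν := fun i => ∫ z, Real.cos (θ ⬝ᵥ z) ∂(ν i)
  set Sν := fun i => ∫ z, Real.sin (θ ⬝ᵥ z) ∂(ν i)
  have hc' : (((1 / 2) * (bilin Γ θ θ * -Cπ) + ∑ i : Fin d, r ^ ((i : ℕ) + 1) *
    (uR R θ i * -Sν i - uR R θ i * -Sπ) : ℝ) : ℂ) = 0 := by rw [hc]; simp
  have hs' : (((1 / 2) * (bilin Γ θ θ * -Sπ) + ∑ i : Fin d, r ^ ((i : ℕ) + 1) *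
    (uR R θ i * Cν i - uR R θ i * Cπ) : ℝ) : ℂ) = 0 := by rw [hs]; simp
  push_cast at hc' hs'
  have e : Complex.I * ∑ i : Fin d, ((r ^ ((i : ℕ) + 1) * uR R θ i : ℝ) : ℂ) *
        ((Cν i : ℂ) + Sν i * Complex.I - (Cπ + Sπ * Complex.I)) =
      (∑ i : Fin d, (r : ℂ) ^ ((i : ℕ) + 1) * (uR R θ i * -Sν i - uR R θ i * -Sπ)) +
      (∑ i : Fin d, (r : ℂ) ^ ((i : ℕ) + 1) * (uR R θ i * Cν i - uR R θ i * Cπ)) * Complex.I := by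
    rw [Finset.mul_sum, Finset.sum_mul, ← Finset.sum_add_distrib]
    refine Finset.sum_congr rfl fun i _ => ?_
    push_cast
    linear_combination (r : ℂ) ^ ((i : ℕ) + 1) * uR R θ i * (Sν i - Sπ) * Complex.I_mul_I
  refine Eq.trans ?_ e.symm
  linear_combination -hc' - Complex.I * hs'

lemma norm_cf_add_smul_sub_le (μ : Measure (Fin d → ℝ)) [IsProbabilityMeasure μ]
    (θ v : Fin d → ℝ) (c : ℝ) {A : ℝ} (hA : 0 ≤ A) :
    ‖cf μ (θ + c • v) - cf μ θ‖ ≤ |c| * A + 2 * μ.real (tailSet v A) := by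
  have hm := measurableSet_tailSet v A
  rw [cf, cf, ← integral_sub (integrable_exp_dotProduct μ _) (integrable_exp_dotProduct μ _)]
  have hi : |c| * A + 2 * μ.real (tailSet v A) =
      ∫ z, (|c| * A + (tailSet v A).indicator (fun _ => (2 : ℝ)) z) ∂μ := by
    rw [integral_add (integrable_const _) ((integrable_const _).indicator hm),
      integral_indicator_const _ hm]
    simp [mul_comm]
  rw [hi]
  refine norm_integral_le_of_norm_le
    ((integrable_const _).add ((integrable_const _).indicator hm)) (Eventually.of_forall fun z => ?_)
  have e : Complex.exp ((((θ + c • v) ⬝ᵥ z : ℝ) : ℂ) * Complex.I) -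
      Complex.exp (((θ ⬝ᵥ z : ℝ) : ℂ) * Complex.I) =
      Complex.exp (((θ ⬝ᵥ z : ℝ) : ℂ) * Complex.I) *
        (Complex.exp (Complex.I * ((c * (v ⬝ᵥ z) : ℝ) : ℂ)) - 1) := by
    rw [mul_sub, ← Complex.exp_add, mul_one]
    congr 2
    rw [add_dotProduct, smul_dotProduct, smul_eq_mul]
    push_cast
    ring
  rw [e, norm_mul, Complex.norm_exp_ofReal_mul_I, one_mul]
  by_cases hz : z ∈ tailSet v A
  · rw [Set.indicator_of_mem hz]
    refine (norm_sub_le _ _).trans ?_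
    rw [mul_comm Complex.I, Complex.norm_exp_ofReal_mul_I, norm_one]
    have : 0 ≤ |c| * A := by positivity
    linarith
  · rw [Set.indicator_of_notMem hz, add_zero]
    refine Real.norm_exp_I_mul_ofReal_sub_one_le.trans ?_
    rw [Real.norm_eq_abs, abs_mul]
    gcongr
    exact (not_le.1 hz).le

lemma HasTail.norm_cf_sub_le {μ : ℝ → Measure (Fin d → ℝ)} (hμ : IsProbFamily μ) {s : ℕ}
    {v : Fin d → ℝ} (h : HasTail μ s v) {K : ℝ} (hK : 0 ≤ K) :
    ∃ C, 0 ≤ C ∧ ∀ t ∈ Set.Ioo (0 : ℝ) 1, ∀ θ : Fin d → ℝ, ∀ c : ℝ, |c| ≤ K * t ^ (s + 1) →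
      ‖cf (μ t) (θ + c • v) - cf (μ t) θ‖ ≤ C * t := by
  obtain ⟨C, hC, h⟩ := h 1
  refine ⟨K * C + 2 * C, by positivity, fun t ht θ c hc => ?_⟩
  have := hμ t ht
  have ht0 := ht.1
  refine (norm_cf_add_smul_sub_le (μ t) θ v c (A := C * (t ^ s)⁻¹) (by positivity)).trans ?_
  have h1 := h t ht
  rw [pow_one] at h1
  have h2 : |c| * (C * (t ^ s)⁻¹) ≤ K * C * t := by
    calc |c| * (C * (t ^ s)⁻¹) ≤ K * t ^ (s + 1) * (C * (t ^ s)⁻¹) := by gcongr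
      _ = K * C * t := by rw [pow_succ]; field_simp
  linarith

/-- The combination `∑ l, r ^ (l + 1) η_l u_l`, where `r = t ^ 4`. -/
def comb (u : Fin d → Fin d → ℝ) (η : Fin d → ℝ) (t : ℝ) : Fin d → ℝ :=
  ∑ l : Fin d, ((t ^ 4) ^ ((l : ℕ) + 1) * η l) • u l

lemma comb_update (u : Fin d → Fin d → ℝ) (η : Fin d → ℝ) (t : ℝ) (k : Fin d) (x : ℝ) :
    comb u (Function.update η k x) t = comb u η t + ((t ^ 4) ^ ((k : ℕ) + 1) * (x - η k)) • u k := by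
  unfold comb
  rw [← Finset.add_sum_erase _ _ (Finset.mem_univ k),
    ← Finset.add_sum_erase (a := k) (f := fun l : Fin d => ((t ^ 4) ^ ((l : ℕ) + 1) * η l) • u l) _
      (Finset.mem_univ k)]
  have : ∑ l ∈ Finset.univ.erase k, ((t ^ 4) ^ ((l : ℕ) + 1) * Function.update η k x l) • u l =
      ∑ l ∈ Finset.univ.erase k, ((t ^ 4) ^ ((l : ℕ) + 1) * η l) • u l :=
    Finset.sum_congr rfl fun l hl => by rw [Function.update_of_ne (Finset.ne_of_mem_erase hl)]
  rw [this, Function.update_self]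
  module

lemma uR_comb (htri : ∀ i j : Fin d, i < j → R i j = 0) {u : Fin d → Fin d → ℝ}
    (hu : ∀ k, IsUk R k (u k)) (η : Fin d → ℝ) (t : ℝ) (i : Fin d) :
    uR R (comb u η t) i = (t ^ 4) ^ ((i : ℕ) + 1) * η i * R i i := by
  have e : uR R (comb u η t) i = ∑ l : Fin d, (t ^ 4) ^ ((l : ℕ) + 1) * η l * uR R (u l) i := by
    simp only [uR, comb, Finset.sum_apply, Pi.smul_apply, smul_eq_mul, Finset.sum_mul,
      Finset.mul_sum]
    rw [Finset.sum_comm]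
    simp only [mul_assoc]
  simp only [e, (hu _).uR_eq htri]
  simp

lemma bilin_comb (u : Fin d → Fin d → ℝ) (η : Fin d → ℝ) (t : ℝ) :
    bilin Γ (comb u η t) (comb u η t) = ∑ l : Fin d, ∑ m : Fin d,
      (t ^ 4) ^ ((l : ℕ) + 1) * η l * ((t ^ 4) ^ ((m : ℕ) + 1) * η m) * bilin Γ (u l) (u m) := by
  have e : ∀ a b : Fin d → ℝ, bilin Γ a b = a ⬝ᵥ Γ.mulVec b := fun a b => by
    simp [bilin, dotProduct, Matrix.mulVec, Finset.mul_sum, mul_assoc]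
  simp only [e, comb, Matrix.mulVec_sum, dotProduct_sum, sum_dotProduct, Matrix.mulVec_smul,
    smul_dotProduct, dotProduct_smul, smul_eq_mul]
  rw [Finset.sum_comm]
  refine Finset.sum_congr rfl fun l _ => ?_
  rw [Finset.mul_sum]
  refine Finset.sum_congr rfl fun m _ => ?_
  ring

end

section

variable {d : ℕ} {Γ R : Matrix (Fin d) (Fin d) ℝ}

lemma norm_sum_sub_le {ι E : Type*} [Fintype ι] [DecidableEq ι] [NormedAddCommGroup E] {f : ι → E}
    {g : ι → ℝ} (j : ι) (h : ∀ i, i ≠ j → ‖f i‖ ≤ g i) (hg : 0 ≤ g j) :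
    ‖∑ i, f i - f j‖ ≤ ∑ i, g i := by
  rw [← Finset.add_sum_erase _ _ (Finset.mem_univ j), add_sub_cancel_left,
    ← Finset.add_sum_erase _ g (Finset.mem_univ j)]
  refine (norm_sum_le_of_le _ fun i hi => h i (Finset.ne_of_mem_erase hi)).trans ?_
  linarith

section CharFun

variable {π : ℝ → Measure (Fin d → ℝ)} {ν : Fin d → ℝ → Measure (Fin d → ℝ)}

lemma IsBARSolutionFamily.norm_cf_boundary_sub_le (h : IsBARSolutionFamily Γ R π ν)
    (htri : ∀ i j : Fin d, i < j → R i j = 0) (hR : IsPMatrix R)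
    {u : Fin d → Fin d → ℝ} (hu : ∀ k, IsUk R k (u k)) (k : Fin d) {m : ℝ}
    (hm : 2 * R k k * m = bilin Γ (u k) (u k)) {M : ℝ} (hM : 0 ≤ M) :
    ∃ C, 0 ≤ C ∧ ∀ t ∈ Set.Ioo (0 : ℝ) 1, ∀ η : Fin d → ℝ, (∀ l, |η l| ≤ M) →
      (∀ l < k, η l = 0) →
      ‖(η k : ℂ) * (cf (π t) (comb u η t) * (1 - η k * m * Complex.I) -
        cf (ν k t) (comb u η t))‖ ≤ C * t ^ 4 := by
  have hRk := hR.diag_pos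
  set K₁ := ∑ p : Fin d × Fin d, M ^ 2 * |bilin Γ (u p.1) (u p.2)| with hK₁
  set K₂ := ∑ i, M * R i i * 2 with hK₂
  have hK₁0 : 0 ≤ K₁ := by positivity
  have hK₂0 : 0 ≤ K₂ := Finset.sum_nonneg fun i _ => by have := hRk i; positivity
  refine ⟨(K₂ + K₁) / R k k, by have := hRk k; positivity, fun t ht η hη hη0 => ?_⟩
  have hsol := h t ht
  have := hsol.prob
  have := hsol.prob_boundary
  have key := hsol.cf_eq (comb u η t)
  simp only [uR_comb htri hu] at key
  set r := t ^ 4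
  have hr := hsol.pos
  have hr1 := hsol.lt_one
  rw [bilin_comb, ← Fintype.sum_prod_type'
    (f := fun l m : Fin d => r ^ ((l : ℕ) + 1) * η l * (r ^ ((m : ℕ) + 1) * η m) *
      bilin Γ (u l) (u m))] at key
  set φ := cf (π t) (comb u η t)
  set ψ : Fin d → ℂ := fun i => cf (ν i t) (comb u η t) with hψ
  have hφ : ‖φ‖ ≤ 1 := norm_cf_le_one _ _
  have hψ1 : ∀ i, ‖ψ i‖ ≤ 1 := fun i => norm_cf_le_one _ _
  have hx : ∀ l : Fin d, |r ^ ((l : ℕ) + 1) * η l| ≤ r ^ ((k : ℕ) + 1) * M := by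
    intro l
    rcases lt_or_ge l k with hl | hl
    · rw [hη0 l hl, mul_zero, abs_zero]
      positivity
    · rw [abs_mul, abs_of_pos (by positivity : 0 < r ^ ((l : ℕ) + 1))]
      refine mul_le_mul (pow_le_pow_of_le_one hr.le hr1.le ?_) (hη l) (abs_nonneg _) (by positivity)
      exact Nat.succ_le_succ hl
  have hx' : ∀ l : Fin d, l ≠ k → |r ^ ((l : ℕ) + 1) * η l| ≤ r ^ ((k : ℕ) + 2) * M := by
    intro l hlk
    rcases lt_or_gt_of_ne hlk with hl | hl
    · rw [hη0 l hl, mul_zero, abs_zero]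
      positivity
    · rw [abs_mul, abs_of_pos (by positivity : 0 < r ^ ((l : ℕ) + 1))]
      refine mul_le_mul (pow_le_pow_of_le_one hr.le hr1.le ?_) (hη l) (abs_nonneg _) (by positivity)
      exact Nat.succ_le_succ hl
  have hE₁ := norm_sum_sub_le (f := fun p : Fin d × Fin d => r ^ ((p.1 : ℕ) + 1) * η p.1 *
      (r ^ ((p.2 : ℕ) + 1) * η p.2) * bilin Γ (u p.1) (u p.2))
    (g := fun p => r ^ (2 * (k : ℕ) + 3) * (M ^ 2 * |bilin Γ (u p.1) (u p.2)|)) (k, k) (by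
      rintro ⟨l, n⟩ hln
      have hor : l ≠ k ∨ n ≠ k := by
        by_contra hc
        push Not at hc
        exact hln (by rw [hc.1, hc.2])
      rw [Real.norm_eq_abs, abs_mul, abs_mul, ← mul_assoc]
      refine mul_le_mul_of_nonneg_right ?_ (abs_nonneg _)
      rcases hor with hl | hn
      · calc _ ≤ r ^ ((k : ℕ) + 2) * M * (r ^ ((k : ℕ) + 1) * M) := by
              gcongr
              · exact hx' l hl
              · exact hx n
          _ = _ := by ring
      · calc _ ≤ r ^ ((k : ℕ) + 1) * M * (r ^ ((k : ℕ) + 2) * M) := by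
              gcongr
              · exact hx l
              · exact hx' n hn
          _ = _ := by ring) (by positivity)
  have hE₂ := norm_sum_sub_le
    (f := fun i : Fin d => ((r ^ ((i : ℕ) + 1) * (r ^ ((i : ℕ) + 1) * η i * R i i) : ℝ) : ℂ) *
      (ψ i - φ))
    (g := fun i => r ^ (2 * (k : ℕ) + 3) * (M * R i i * 2)) k (by
      intro i hik
      have h2 : ‖ψ i - φ‖ ≤ 2 := (norm_sub_le _ _).trans (by linarith [hψ1 i])
      rcases lt_or_gt_of_ne hik with hi | hi
      · rw [hη0 i hi]
        have := hRk i
        simp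
        positivity
      · have := hRk i
        rw [norm_mul, Complex.norm_real, Real.norm_eq_abs, abs_mul, abs_mul, abs_of_pos this,
          abs_of_pos (by positivity : 0 < r ^ ((i : ℕ) + 1))]
        have h3 : r ^ ((i : ℕ) + 1) ≤ r ^ ((k : ℕ) + 1) :=
          pow_le_pow_of_le_one hr.le hr1.le (Nat.succ_le_succ (le_of_lt hi))
        calc _ ≤ r ^ ((k : ℕ) + 1) * (r ^ ((k : ℕ) + 2) * M * R i i) * 2 := by
              gcongr
              exact hx' i hik
          _ = _ := by ring) (by have := hRk k; positivity)
  rw [← Finset.mul_sum] at hE₁ hE₂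
  rw [← hK₁, Real.norm_eq_abs] at hE₁
  rw [← hK₂] at hE₂
  set S₁ := ∑ p : Fin d × Fin d, r ^ ((p.1 : ℕ) + 1) * η p.1 *
      (r ^ ((p.2 : ℕ) + 1) * η p.2) * bilin Γ (u p.1) (u p.2)
  set S₂ := ∑ i : Fin d, ((r ^ ((i : ℕ) + 1) * (r ^ ((i : ℕ) + 1) * η i * R i i) : ℝ) : ℂ) *
      (ψ i - φ)
  set E₁ := S₁ - r ^ ((k : ℕ) + 1) * η k * (r ^ ((k : ℕ) + 1) * η k) * bilin Γ (u k) (u k)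
    with hE₁'
  set E₂ := S₂ - ((r ^ ((k : ℕ) + 1) * (r ^ ((k : ℕ) + 1) * η k * R k k) : ℝ) : ℂ) *
      (ψ k - φ) with hE₂'
  set X := (η k : ℂ) * (φ * (1 - η k * m * Complex.I) - ψ k) with hX
  have hE₁c : (E₁ : ℂ) = S₁ - (r : ℂ) ^ ((k : ℕ) + 1) * η k * (r ^ ((k : ℕ) + 1) * η k) *
      (2 * R k k * m) := by
    rw [hE₁', ← hm]
    push_cast
    ring
  have hkey : ((r ^ (2 * (k : ℕ) + 2) * R k k : ℝ) : ℂ) * X =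
      E₂ + (1 / 2 : ℂ) * Complex.I * E₁ * φ := by
    rw [hE₁c, hE₂', hX]
    push_cast
    linear_combination (-Complex.I) * key - S₂ * Complex.I_mul_I
  have hn := congrArg norm hkey
  have hRkk := hRk k
  rw [norm_mul, Complex.norm_real, Real.norm_eq_abs, abs_of_pos (by positivity)] at hn
  have hb : ‖E₂ + (1 / 2 : ℂ) * Complex.I * E₁ * φ‖ ≤ r ^ (2 * (k : ℕ) + 3) * (K₂ + K₁) := by
    refine (norm_add_le _ _).trans ?_
    have : ‖(1 / 2 : ℂ) * Complex.I * E₁ * φ‖ ≤ |E₁| := by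
      rw [norm_mul, norm_mul, norm_mul, Complex.norm_real, Complex.norm_I, Real.norm_eq_abs]
      norm_num
      nlinarith [abs_nonneg E₁, norm_nonneg φ]
    linarith
  rw [← hn] at hb
  have e : r ^ (2 * (k : ℕ) + 3) * (K₂ + K₁) =
      r ^ (2 * (k : ℕ) + 2) * R k k * ((K₂ + K₁) / R k k * r) := by
    field_simp
    ring
  rw [e] at hb
  exact le_of_mul_le_mul_left hb (by positivity)

/-- Freezing the `k`-th coordinate, when the lower ones vanish. -/
lemma IsBARSolutionFamily.norm_cf_update_sub_le (h : IsBARSolutionFamily Γ R π ν)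
    (htri : ∀ i j : Fin d, i < j → R i j = 0) (hR : IsPMatrix R)
    {u : Fin d → Fin d → ℝ} (hu : ∀ k, IsUk R k (u k)) (k : Fin d) {m : ℝ}
    (hm : 2 * R k k * m = bilin Γ (u k) (u k)) {η : Fin d → ℝ} (hη : ∀ l < k, η l = 0) :
    ∃ C, 0 ≤ C ∧ ∀ t ∈ Set.Ioo (0 : ℝ) 1,
      ‖cf (π t) (comb u η t) * (1 - η k * m * Complex.I) -
        cf (π t) (comb u (Function.update η k 0) t)‖ ≤ C * t := by
  by_cases hk : η k = 0
  · refine ⟨0, le_rfl, fun t _ => ?_⟩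
    rw [← hk, Function.update_eq_self, hk]
    simp
  have hk0 : 0 < |η k| := abs_pos.2 hk
  set M := 1 + ∑ l, |η l| with hM
  have hs : 0 ≤ ∑ l, |η l| := by positivity
  have hle : ∀ l, |η l| ≤ M := fun l => by
    have := Finset.single_le_sum (f := fun l => |η l|) (fun _ _ => abs_nonneg _)
      (Finset.mem_univ l)
    linarith
  obtain ⟨C₁, hC₁, hbar⟩ := h.norm_cf_boundary_sub_le htri hR hu k hm (M := M) (by linarith)
  have hν := h.hasTail_boundary_self hu (k := k) fun l _ => (h.hasTail htri hR hu l).2 k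
  obtain ⟨C₂, hC₂, hdν⟩ := hν.norm_cf_sub_le (h.prob_boundary k) (K := 1 + |η k|) (by positivity)
  obtain ⟨C₃, hC₃, hdπ⟩ := (h.hasTail htri hR hu k).1.norm_cf_sub_le h.prob zero_le_one
  refine ⟨C₁ / |η k| + C₂ + C₁ + |m| + C₃, by positivity, fun t ht => ?_⟩
  have ht0 := ht.1
  have ht1 := ht.2.le
  have := h.prob t ht
  have pow_le : ∀ n, 1 ≤ n → t ^ n ≤ t := fun n hn => by
    simpa using pow_le_pow_of_le_one ht0.le ht1 hn
  set φ := cf (π t) (comb u η t)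
  set φ₀ := cf (π t) (comb u (Function.update η k 0) t)
  set η' := Function.update η k (t ^ 2) with hη'
  set φ' := cf (π t) (comb u η' t)
  set ψ := cf (ν k t) (comb u η t)
  set ψ' := cf (ν k t) (comb u η' t)
  have hη'k : η' k = t ^ 2 := Function.update_self _ _ _
  have b1 : ‖φ * (1 - η k * m * Complex.I) - ψ‖ ≤ C₁ / |η k| * t := by
    have := hbar t ht η hle hη
    rw [norm_mul, Complex.norm_real, Real.norm_eq_abs] at this
    have h4 := mul_le_mul_of_nonneg_left (pow_le 4 (by norm_num)) hC₁
    rw [div_mul_eq_mul_div, le_div_iff₀ hk0, mul_comm]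
    exact this.trans h4
  have b2 : ‖ψ' - ψ‖ ≤ C₂ * t := by
    have := hdν t ht (comb u η t) ((t ^ 4) ^ ((k : ℕ) + 1) * (t ^ 2 - η k)) (by
      rw [abs_mul, ← pow_mul, abs_of_pos (by positivity), mul_comm]
      have h1 : |t ^ 2 - η k| ≤ 1 + |η k| := by
        refine (abs_sub _ _).trans ?_
        rw [abs_of_pos (by positivity)]
        have := pow_le 2 (by norm_num)
        linarith
      have h2 : t ^ (4 * ((k : ℕ) + 1)) ≤ t ^ (4 * (k : ℕ) + 1 + 1) :=
        pow_le_pow_of_le_one ht0.le ht1 (by omega)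
      gcongr)
    rwa [← comb_update] at this
  have b3 : ‖φ' * (1 - (t ^ 2 : ℝ) * m * Complex.I) - ψ'‖ ≤ C₁ * t := by
    have := hbar t ht η' (fun l => by
      by_cases hl : l = k
      · rw [hl, hη'k, abs_of_pos (by positivity)]
        have := pow_le 2 (by norm_num)
        linarith
      · rw [hη', Function.update_of_ne hl]
        exact hle l) (fun l hl => by rw [hη', Function.update_of_ne hl.ne, hη l hl])
    rw [hη'k, norm_mul, Complex.norm_real, Real.norm_eq_abs, abs_of_pos (by positivity),
      show C₁ * t ^ 4 = t ^ 2 * (C₁ * t ^ 2) by ring] at this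
    have h4 := mul_le_mul_of_nonneg_left (pow_le 2 (by norm_num)) hC₁
    exact (le_of_mul_le_mul_left this (by positivity)).trans h4
  have b4 : ‖φ' * ((t ^ 2 : ℝ) * m * Complex.I)‖ ≤ |m| * t := by
    have h1 : ‖φ'‖ ≤ 1 := norm_cf_le_one _ _
    rw [norm_mul, norm_mul, norm_mul, Complex.norm_I, Complex.norm_real, Complex.norm_real,
      Real.norm_eq_abs, Real.norm_eq_abs, abs_of_pos (by positivity : 0 < t ^ 2), mul_one,
      mul_comm (t ^ 2)]
    have h2 := mul_le_mul_of_nonneg_left (pow_le 2 (by norm_num)) (abs_nonneg m)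
    have h3 : 0 ≤ |m| * t ^ 2 := by positivity
    nlinarith
  have b5 : ‖φ' - φ₀‖ ≤ C₃ * t := by
    have := hdπ t ht (comb u (Function.update η k 0) t) ((t ^ 4) ^ ((k : ℕ) + 1) *
      (t ^ 2 - Function.update η k 0 k)) (by
      rw [Function.update_self, sub_zero, ← pow_mul, ← pow_add, abs_of_pos (by positivity), one_mul]
      exact pow_le_pow_of_le_one ht0.le ht1 (by omega))
    rwa [← comb_update, Function.update_idem] at this
  have e : φ * (1 - η k * m * Complex.I) - φ₀ = (φ * (1 - η k * m * Complex.I) - ψ) - (ψ' - ψ)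
      - (φ' * (1 - (t ^ 2 : ℝ) * m * Complex.I) - ψ') - φ' * ((t ^ 2 : ℝ) * m * Complex.I)
      + (φ' - φ₀) := by
    ring
  rw [e]
  refine (norm_add_le _ _).trans ((add_le_add ((norm_sub_le _ _).trans (add_le_add
    ((norm_sub_le _ _).trans (add_le_add ((norm_sub_le _ _).trans (add_le_add b1 b2)) b3)) b4))
    b5).trans (le_of_eq ?_))
  ring

end CharFun

end

section

variable {d : ℕ} {Γ R : Matrix (Fin d) (Fin d) ℝ}
  {π : ℝ → Measure (Fin d → ℝ)} {ν : Fin d → ℝ → Measure (Fin d → ℝ)}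

lemma IsBARSolutionFamily.norm_cf_comb_mul_prod_sub_le (h : IsBARSolutionFamily Γ R π ν)
    (htri : ∀ i j : Fin d, i < j → R i j = 0) (hR : IsPMatrix R)
    {u : Fin d → Fin d → ℝ} (hu : ∀ k, IsUk R k (u k)) {m : Fin d → ℝ}
    (hm : ∀ k, 2 * R k k * m k = bilin Γ (u k) (u k)) (η : Fin d → ℝ) :
    ∃ C, 0 ≤ C ∧ ∀ t ∈ Set.Ioo (0 : ℝ) 1,
      ‖cf (π t) (comb u η t) * ∏ l, (1 - η l * m l * Complex.I) - 1‖ ≤ C * t := by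
  suffices claim : ∀ n : ℕ, ∀ η : Fin d → ℝ, (∀ l : Fin d, (l : ℕ) < d - n → η l = 0) →
      ∃ C, 0 ≤ C ∧ ∀ t ∈ Set.Ioo (0 : ℝ) 1,
        ‖cf (π t) (comb u η t) * ∏ l, (1 - η l * m l * Complex.I) - 1‖ ≤ C * t from
    claim d η fun l hl => by omega
  intro n
  induction n with
  | zero =>
    intro η hη
    refine ⟨0, le_rfl, fun t ht => ?_⟩
    have := h.prob t ht
    have hη : ∀ l, η l = 0 := fun l => hη l (by omega)
    have : comb u η t = 0 := by simp [comb, hη]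
    simp [this, cf_zero, hη]
  | succ n ih =>
    intro η hη
    by_cases hn : n < d
    · set k : Fin d := ⟨d - (n + 1), by omega⟩ with hk
      obtain ⟨C₁, hC₁, h₁⟩ := h.norm_cf_update_sub_le htri hR hu k (hm k) (η := η)
        fun l hl => hη l hl
      obtain ⟨C₂, hC₂, h₂⟩ := ih (Function.update η k 0) fun l hl => by
        by_cases hlk : l = k
        · rw [hlk, Function.update_self]
        · rw [Function.update_of_ne hlk]
          refine hη l ?_
          have : (l : ℕ) ≠ d - (n + 1) := fun hc => hlk (Fin.ext hc)
          omega
      set P := ∏ l, (1 - (Function.update η k 0 l : ℝ) * m l * Complex.I) with hP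
      have e : ∏ l, (1 - η l * m l * Complex.I) = (1 - η k * m k * Complex.I) * P := by
        rw [hP, ← Finset.mul_prod_erase _ _ (Finset.mem_univ k),
          ← Finset.mul_prod_erase (a := k)
            (f := fun l => 1 - ((Function.update η k 0 l : ℝ) : ℂ) * m l * Complex.I) _
            (Finset.mem_univ k), Function.update_self]
        rw [Complex.ofReal_zero, zero_mul, zero_mul, sub_zero, one_mul]
        congr 1
        exact Finset.prod_congr rfl fun l hl => by
          rw [Function.update_of_ne (Finset.ne_of_mem_erase hl)]
      refine ⟨C₁ * ‖P‖ + C₂, by positivity, fun t ht => ?_⟩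
      have i1 := mul_le_mul_of_nonneg_right (h₁ t ht) (norm_nonneg P)
      rw [← norm_mul] at i1
      have i2 := h₂ t ht
      have e2 : cf (π t) (comb u η t) * ∏ l, (1 - η l * m l * Complex.I) - 1 =
          (cf (π t) (comb u η t) * (1 - η k * m k * Complex.I) -
            cf (π t) (comb u (Function.update η k 0) t)) * P +
          (cf (π t) (comb u (Function.update η k 0) t) * P - 1) := by
        rw [e]
        ring
      rw [e2]
      refine (norm_add_le _ _).trans ((add_le_add i1 i2).trans (le_of_eq ?_))
      ring
    · exact ih η fun l hl => hη l (by omega)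

lemma IsBARSolutionFamily.norm_cf_comb_sub_le (h : IsBARSolutionFamily Γ R π ν)
    (htri : ∀ i j : Fin d, i < j → R i j = 0) (hR : IsPMatrix R)
    {u : Fin d → Fin d → ℝ} (hu : ∀ k, IsUk R k (u k)) (η : Fin d → ℝ) :
    ∃ C, 0 ≤ C ∧ ∀ t ∈ Set.Ioo (0 : ℝ) 1,
      ‖cf (π t) (comb u η t) - cf (π t) (comb (fun l => Pi.single l 1) η t)‖ ≤ C * t := by
  have htail : ∀ l : Fin d, HasTail π (4 * (l : ℕ) + 1) (u l - Pi.single l 1) := by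
    intro l
    have e : u l - Pi.single l 1 =
        ∑ j ∈ Finset.univ.filter (· < l), u l j • (Pi.single j 1 : Fin d → ℝ) := by
      ext i
      simp only [Pi.sub_apply, Finset.sum_apply, Pi.smul_apply, smul_eq_mul, Pi.single_apply,
        mul_ite, mul_one, mul_zero, Finset.sum_ite_eq, Finset.mem_filter, Finset.mem_univ, true_and]
      rcases lt_trichotomy i l with hi | rfl | hi
      · simp [hi, hi.ne]
      · simp [(hu i).1]
      · simp [hi.ne', hi.not_gt, (hu l).2.1 i hi]
    rw [e]
    refine HasTail.sum h.prob _ fun j hj => ?_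
    have hj := (Finset.mem_filter.1 hj).2
    exact ((hasTail_single h.prob hu fun m _ => (h.hasTail htri hR hu m).1).mono h.prob
      (by have : (j : ℕ) < l := hj
          omega)).smul h.prob _
  have claim : ∀ S : Finset (Fin d), ∃ C, 0 ≤ C ∧ ∀ t ∈ Set.Ioo (0 : ℝ) 1,
      ‖cf (π t) (comb (fun l => Pi.single l 1) η t +
        ∑ l ∈ S, ((t ^ 4) ^ ((l : ℕ) + 1) * η l) • (u l - Pi.single l 1)) -
          cf (π t) (comb (fun l => Pi.single l 1) η t)‖ ≤ C * t := by
    intro S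
    induction S using Finset.induction_on with
    | empty => exact ⟨0, le_rfl, fun t _ => by simp⟩
    | insert l S hl ih =>
      obtain ⟨C₁, hC₁, h₁⟩ := ih
      obtain ⟨C₂, hC₂, h₂⟩ := (htail l).norm_cf_sub_le h.prob (K := |η l|) (abs_nonneg _)
      refine ⟨C₂ + C₁, by positivity, fun t ht => ?_⟩
      have ht0 := ht.1
      rw [Finset.sum_insert hl, add_comm (_ • _), ← add_assoc, add_mul]
      refine (norm_sub_le_norm_sub_add_norm_sub _ _ _).trans
        (add_le_add (h₂ t ht _ _ ?_) (h₁ t ht))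
      rw [abs_mul, ← pow_mul, abs_of_pos (by positivity), mul_comm]
      have := pow_le_pow_of_le_one ht0.le ht.2.le
        (show 4 * (l : ℕ) + 1 + 1 ≤ 4 * ((l : ℕ) + 1) by omega)
      gcongr
  obtain ⟨C, hC, h'⟩ := claim Finset.univ
  refine ⟨C, hC, fun t ht => ?_⟩
  have e : comb u η t = comb (fun l => Pi.single l 1) η t +
      ∑ l : Fin d, ((t ^ 4) ^ ((l : ℕ) + 1) * η l) • (u l - Pi.single l 1) := by
    simp only [comb, smul_sub, Finset.sum_sub_distrib]
    abel
  rw [e]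
  exact h' t ht

/-- Convergence of the characteristic functions of the scaled stationary distributions. -/
theorem IsBARSolutionFamily.tendsto_cf (h : IsBARSolutionFamily Γ R π ν)
    (htri : ∀ i j : Fin d, i < j → R i j = 0) (hR : IsPMatrix R)
    {u : Fin d → Fin d → ℝ} (hu : ∀ k, IsUk R k (u k)) {m : Fin d → ℝ}
    (hm : ∀ k, 2 * R k k * m k = bilin Γ (u k) (u k)) (η : Fin d → ℝ) :
    Tendsto (fun t => cf (π t) fun i => (t ^ 4) ^ ((i : ℕ) + 1) * η i)
      (nhdsWithin 0 (Set.Ioo 0 1)) (nhds (∏ l, (1 - η l * m l * Complex.I)⁻¹)) := by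
  obtain ⟨C₁, hC₁, h₁⟩ := h.norm_cf_comb_mul_prod_sub_le htri hR hu hm η
  obtain ⟨C₂, hC₂, h₂⟩ := h.norm_cf_comb_sub_le htri hR hu η
  set P := ∏ l, (1 - η l * m l * Complex.I) with hP
  have hP0 : P ≠ 0 := by
    refine Finset.prod_ne_zero_iff.2 fun l _ hc => ?_
    have := congrArg Complex.re hc
    simp at this
  have hid : Tendsto (fun t : ℝ => t) (nhdsWithin 0 (Set.Ioo 0 1)) (nhds 0) :=
    tendsto_nhdsWithin_of_tendsto_nhds tendsto_id
  rw [Finset.prod_inv_distrib, ← hP, tendsto_iff_norm_sub_tendsto_zero]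
  refine squeeze_zero' (Eventually.of_forall fun _ => norm_nonneg _) ?_
    (by simpa using hid.const_mul (C₂ + C₁ * ‖P⁻¹‖))
  filter_upwards [self_mem_nhdsWithin] with t ht
  have e : (fun i : Fin d => (t ^ 4) ^ ((i : ℕ) + 1) * η i) =
      comb (fun l => Pi.single l 1) η t := by
    ext i
    simp [comb, Finset.sum_apply, Pi.single_apply]
  rw [e]
  set φ := cf (π t) (comb (fun l => Pi.single l 1) η t)
  have i1 := h₁ t ht
  have i2 := h₂ t ht
  set ψ := cf (π t) (comb u η t)
  have e2 : φ - P⁻¹ = -(ψ - φ) + (ψ * P - 1) * P⁻¹ := by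
    field_simp
    ring
  rw [e2]
  refine (norm_add_le _ _).trans ?_
  rw [norm_neg, norm_mul, add_mul]
  refine add_le_add i2 ?_
  have := mul_le_mul_of_nonneg_right i1 (norm_nonneg P⁻¹)
  exact this.trans (le_of_eq (by rw [norm_inv]; ring))

end

section

lemma expMean_eq_expMeasure (m : ℝ) : expMean m = ProbabilityTheory.expMeasure m⁻¹ := by
  unfold expMean ProbabilityTheory.expMeasure ProbabilityTheory.gammaMeasure
  congr 1
  ext x
  have := ProbabilityTheory.exponentialPDF_eq m⁻¹ x
  rw [ProbabilityTheory.exponentialPDF, ProbabilityTheory.exponentialPDFReal] at this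
  rw [ProbabilityTheory.gammaPDF, this, neg_div, div_eq_inv_mul]

lemma isProbabilityMeasure_expMean {m : ℝ} (hm : 0 < m) : IsProbabilityMeasure (expMean m) := by
  rw [expMean_eq_expMeasure]
  exact ProbabilityTheory.isProbabilityMeasure_expMeasure (inv_pos.2 hm)

/-- The characteristic function of the exponential distribution. -/
lemma integral_exp_mul_I_expMean {m : ℝ} (hm : 0 < m) (t : ℝ) :
    ∫ x, Complex.exp (((t * x : ℝ) : ℂ) * Complex.I) ∂(expMean m) =
      (1 - t * m * Complex.I)⁻¹ := by
  have hmeas : Measurable fun x : ℝ => if 0 ≤ x then m⁻¹ * Real.exp (-x / m) else 0 :=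
    Measurable.ite measurableSet_Ici (by fun_prop) measurable_const
  have hm' : (m : ℂ) ≠ 0 := by exact_mod_cast hm.ne'
  have ha : (-(m : ℂ)⁻¹ + t * Complex.I).re < 0 := by
    rw [← Complex.ofReal_inv]
    simpa using hm
  have ha0 : -(m : ℂ)⁻¹ + t * Complex.I ≠ 0 := fun hc => by
    rw [hc] at ha
    simp at ha
  have hb0 : (1 - t * m * Complex.I : ℂ) ≠ 0 := fun hc => by
    have := congrArg Complex.re hc
    simp at this
  unfold expMean
  rw [integral_withDensity_eq_integral_toReal_smul hmeas.ennreal_ofReal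
    (Eventually.of_forall fun _ => ENNReal.ofReal_lt_top)]
  have e : ∀ x : ℝ, (ENNReal.ofReal (if 0 ≤ x then m⁻¹ * Real.exp (-x / m) else 0)).toReal •
      Complex.exp (((t * x : ℝ) : ℂ) * Complex.I) = (Set.Ici (0 : ℝ)).indicator
        (fun x : ℝ => (m : ℂ)⁻¹ * Complex.exp ((-(m : ℂ)⁻¹ + t * Complex.I) * x)) x := by
    intro x
    by_cases hx : 0 ≤ x
    · rw [if_pos hx, Set.indicator_of_mem (Set.mem_Ici.2 hx),
        ENNReal.toReal_ofReal (by positivity), Complex.real_smul]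
      push_cast
      rw [mul_assoc, ← Complex.exp_add]
      congr 2
      field_simp
    · rw [if_neg hx, Set.indicator_of_notMem (by simpa using hx)]
      simp
  simp_rw [e]
  rw [integral_indicator measurableSet_Ici, integral_Ici_eq_integral_Ioi, integral_const_mul,
    integral_exp_mul_complex_Ioi ha]
  simp only [Complex.ofReal_zero, mul_zero, Complex.exp_zero]
  have : -(m : ℂ)⁻¹ + t * Complex.I = -((m : ℂ)⁻¹ * (1 - t * m * Complex.I)) := by
    field_simp
    ring
  rw [this, neg_div_neg_eq, one_div, mul_inv, inv_inv, inv_mul_cancel_left₀ hm']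

variable {d : ℕ}

lemma isProbabilityMeasure_prodExp {m : Fin d → ℝ} (hm : ∀ k, 0 < m k) :
    IsProbabilityMeasure (prodExp m) := by
  have := fun k => isProbabilityMeasure_expMean (hm k)
  unfold prodExp
  infer_instance

lemma cf_prodExp {m : Fin d → ℝ} (hm : ∀ k, 0 < m k) (η : Fin d → ℝ) :
    cf (prodExp m) η = ∏ l, (1 - η l * m l * Complex.I)⁻¹ := by
  have := fun k => isProbabilityMeasure_expMean (hm k)
  unfold cf prodExp
  simp_rw [← integral_exp_mul_I_expMean (hm _), ← integral_fintype_prod_eq_prod]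
  congr with z
  rw [← Complex.exp_sum, ← Finset.sum_mul, dotProduct]
  push_cast
  rfl

lemma charFun_map_toLp (μ : Measure (Fin d → ℝ)) (θ : EuclideanSpace ℝ (Fin d)) :
    charFun (μ.map (WithLp.toLp 2)) θ = cf μ θ.ofLp := by
  rw [charFun_apply, ← MeasurableEquiv.coe_toLp, integral_map_equiv]
  unfold cf
  congr with z

/-- The Lévy continuity theorem in `Fin d → ℝ`, along a countably generated filter. -/
lemma tendsto_integral_of_tendsto_cf {ι : Type*} {l : Filter ι} [l.IsCountablyGenerated]
    {μ : ι → Measure (Fin d → ℝ)} (hμ : ∀ i, IsProbabilityMeasure (μ i))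
    {μ₀ : Measure (Fin d → ℝ)} [hμ₀ : IsProbabilityMeasure μ₀]
    (h : ∀ θ, Tendsto (fun i => cf (μ i) θ) l (nhds (cf μ₀ θ)))
    (g : BoundedContinuousFunction (Fin d → ℝ) ℝ) :
    Tendsto (fun i => ∫ z, g z ∂(μ i)) l (nhds (∫ z, g z ∂μ₀)) := by
  refine tendsto_of_seq_tendsto fun x hx => ?_
  have hm : Measurable (WithLp.toLp 2 : (Fin d → ℝ) → EuclideanSpace ℝ (Fin d)) :=
    WithLp.measurable_toLp 2 _
  let ρ : ℕ → ProbabilityMeasure (EuclideanSpace ℝ (Fin d)) := fun n =>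
    ⟨(μ (x n)).map (WithLp.toLp 2), Measure.isProbabilityMeasure_map hm.aemeasurable⟩
  let ρ₀ : ProbabilityMeasure (EuclideanSpace ℝ (Fin d)) :=
    ⟨μ₀.map (WithLp.toLp 2), Measure.isProbabilityMeasure_map hm.aemeasurable⟩
  have key : Tendsto ρ atTop (nhds ρ₀) := by
    refine ProbabilityMeasure.tendsto_of_tendsto_charFun fun θ => ?_
    simp only [ρ, ρ₀, ProbabilityMeasure.coe_mk, charFun_map_toLp]
    exact (h _).comp hx
  have := ProbabilityMeasure.tendsto_iff_forall_integral_tendsto.1 key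
    (g.compContinuous ⟨WithLp.ofLp, PiLp.continuous_ofLp 2 _⟩)
  simp only [ρ, ρ₀, ProbabilityMeasure.coe_mk] at this
  simp_rw [← MeasurableEquiv.coe_toLp, integral_map_equiv] at this
  simpa [Function.comp_def] using this

lemma cf_map_mul (μ : Measure (Fin d → ℝ)) (c θ : Fin d → ℝ) :
    cf (μ.map fun z i => c i * z i) θ = cf μ fun i => c i * θ i := by
  unfold cf
  have hc : Measurable fun (z : Fin d → ℝ) i => c i * z i :=
    measurable_pi_lambda _ fun i =>
      (measurable_pi_apply i : Measurable fun z : Fin d → ℝ => z i).const_mul (c i)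
  rw [integral_map hc.aemeasurable (by
    have := continuous_dotProduct_left θ
    exact (by fun_prop : Continuous fun z : Fin d → ℝ =>
      Complex.exp (((θ ⬝ᵥ z : ℝ) : ℂ) * Complex.I)).aestronglyMeasurable)]
  simp only [dotProduct]
  simp_rw [mul_left_comm, ← mul_assoc]

variable {Γ R : Matrix (Fin d) (Fin d) ℝ}
  {π : ℝ → Measure (Fin d → ℝ)} {ν : Fin d → ℝ → Measure (Fin d → ℝ)}

lemma BARFamily.isBARSolution (h : BARFamily Γ R π ν) {r : ℝ} (hr : r ∈ Set.Ioo (0 : ℝ) 1) :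
    IsBARSolution Γ R r (π r) fun i => ν i r := by
  obtain ⟨h1, -, h2, h3⟩ := h r hr
  refine ⟨hr.1, hr.2, h1, fun i => (h2 i).1, fun i => ?_, h3⟩
  have := (h2 i).1
  have h0 : MeasurableSet {z : Fin d → ℝ | z i = 0} :=
    (isClosed_eq (continuous_apply i) continuous_const).measurableSet
  refine (prob_compl_eq_zero_iff h0).2 (le_antisymm prob_le_one ?_)
  rw [← (h2 i).2]
  exact measure_mono fun z hz => hz.2

lemma BARFamily.isBARSolutionFamily (h : BARFamily Γ R π ν) :
    IsBARSolutionFamily Γ R (fun t => π (t ^ 4)) fun i t => ν i (t ^ 4) := fun _ ht =>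
  h.isBARSolution ⟨pow_pos ht.1 4, pow_lt_one₀ ht.1.le ht.2 (by norm_num)⟩

lemma tendsto_sqrt_sqrt : Tendsto (fun r : ℝ => √(√r)) (nhdsWithin 0 (Set.Ioo 0 1))
    (nhdsWithin 0 (Set.Ioo 0 1)) := by
  refine tendsto_nhdsWithin_iff.2 ⟨tendsto_nhdsWithin_of_tendsto_nhds ?_, ?_⟩
  · have : Continuous fun r : ℝ => √(√r) := by fun_prop
    simpa using this.tendsto 0
  · filter_upwards [self_mem_nhdsWithin] with r hr
    refine ⟨Real.sqrt_pos.2 (Real.sqrt_pos.2 hr.1), ?_⟩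
    rw [Real.sqrt_lt' one_pos, Real.sqrt_lt' (by norm_num)]
    simpa using hr.2

lemma sqrt_sqrt_pow_four {r : ℝ} (hr : 0 ≤ r) : √(√r) ^ 4 = r := by
  rw [show 4 = 2 * 2 from rfl, pow_mul, Real.sq_sqrt (Real.sqrt_nonneg r), Real.sq_sqrt hr]

lemma BARFamily.scaledWeakLimit (h : BARFamily Γ R π ν)
    (htri : ∀ i j : Fin d, i < j → R i j = 0) (hR : IsPMatrix R)
    {u : Fin d → Fin d → ℝ} (hu : ∀ k, IsUk R k (u k)) {m : Fin d → ℝ} (hm0 : ∀ k, 0 < m k)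
    (hm : ∀ k, 2 * R k k * m k = bilin Γ (u k) (u k)) :
    ScaledWeakLimit π (prodExp m) := by
  intro g
  have := isProbabilityMeasure_prodExp hm0
  let S : ℝ → (Fin d → ℝ) → Fin d → ℝ := fun r z i => r ^ ((i : ℕ) + 1) * z i
  have hS : ∀ r, Measurable (S r) := fun r => by fun_prop
  classical
  let μ : ℝ → Measure (Fin d → ℝ) := fun r =>
    if r ∈ Set.Ioo (0 : ℝ) 1 then (π r).map (S r) else prodExp m
  have hμ : ∀ r, IsProbabilityMeasure (μ r) := by
    intro r
    by_cases hr : r ∈ Set.Ioo (0 : ℝ) 1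
    · have := (h r hr).1
      simp only [μ, if_pos hr]
      exact Measure.isProbabilityMeasure_map (hS r).aemeasurable
    · simpa only [μ, if_neg hr]
  refine (tendsto_integral_of_tendsto_cf (l := nhdsWithin 0 (Set.Ioo 0 1)) hμ
    (μ₀ := prodExp m) (fun η => ?_) g).congr' ?_
  · rw [cf_prodExp hm0]
    refine ((h.isBARSolutionFamily.tendsto_cf htri hR hu hm η).comp tendsto_sqrt_sqrt).congr' ?_
    filter_upwards [self_mem_nhdsWithin] with r hr
    simp only [Function.comp_apply, sqrt_sqrt_pow_four hr.1.le, μ, if_pos hr, S, cf_map_mul]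
  · filter_upwards [self_mem_nhdsWithin] with r hr
    simp only [μ, if_pos hr]
    exact integral_map (hS r).aemeasurable g.continuous.aestronglyMeasurable

end

/-- Steady-state convergence of SRBM in the multi-scaling regime for a
lower triangular P-reflection matrix, with means
`m_k = (u_kᵀ Γ u_k)/(2 u_kᵀ R_{:,k}) = (u_kᵀ Γ u_k)/(2 R_{kk}) > 0`. -/
theorem srbm_steady_state_convergence_lower_triangular
    {d : ℕ} (hd : 1 ≤ d)
    (Γ R : Matrix (Fin d) (Fin d) ℝ)
    (hΓsymm : Γ.IsSymm) (hΓpd : Γ.PosDef)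
    (hR : IsPMatrix R) (htri : ∀ i j : Fin d, i < j → R i j = 0)
    (π : ℝ → Measure (Fin d → ℝ)) (ν : Fin d → ℝ → Measure (Fin d → ℝ))
    (hBAR : BARFamily Γ R π ν)
    (u : Fin d → Fin d → ℝ) (hu : ∀ k, IsUk R k (u k)) :
    (∀ k, meanOf Γ R (u k) k = quadForm Γ (u k) / (2 * R k k) ∧
      0 < meanOf Γ R (u k) k) ∧
    ScaledWeakLimit π (prodExp fun k => meanOf Γ R (u k) k) := by
  have hmean : ∀ k, meanOf Γ R (u k) k = quadForm Γ (u k) / (2 * R k k) := fun k => by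
    rw [meanOf, (hu k).uR_eq htri, if_pos rfl]
  have hpos : ∀ k, 0 < meanOf Γ R (u k) k := fun k => by
    have h0 : u k ≠ 0 := fun hc => by simpa [hc] using (hu k).1
    rw [hmean]
    exact div_pos (bilin_self_pos hΓpd h0) (mul_pos two_pos (hR.diag_pos k))
  refine ⟨fun k => ⟨hmean k, hpos k⟩, hBAR.scaledWeakLimit htri hR hu hpos fun k => ?_⟩
  rw [hmean, mul_div_cancel₀ _ (mul_pos two_pos (hR.diag_pos k)).ne']
  rfl

end SRBMPaper
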